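/- arXiv:1605.03516 — 5 statements merged into one kernel-verified Lean document; each statement's English description precedes it below -/
import Mathlib

section
/- Let A and B be n×n positive definite complex matrices and t ∈ [0,1]. Then Tr((A♯_t B)² + (A♯_{1−t} B)²) ≤ Tr(A^{2t} B^{2(1−t)} + B^{2t} A^{2(1−t)}). -/
open Matrix ComplexOrder

/-- Real power of a Hermitian matrix via the functional calculus (spectral decomposition). -/
noncomputable def mpow {n : ℕ} (A : Matrix (Fin n) (Fin n) ℂ) (r : ℝ) :
    Matrix (Fin n) (Fin n) ℂ :=
  if hA : A.IsHermitian then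
    (hA.eigenvectorUnitary : Matrix (Fin n) (Fin n) ℂ) *
      Matrix.diagonal (fun i => ((hA.eigenvalues i ^ r : ℝ) : ℂ)) *
      (star hA.eigenvectorUnitary : Matrix (Fin n) (Fin n) ℂ)
  else 0

/-- The t-geometric mean `A ♯ₜ B = A^{1/2} (A^{-1/2} B A^{-1/2})^t A^{1/2}`. -/
noncomputable def geomMean {n : ℕ} (A B : Matrix (Fin n) (Fin n) ℂ) (t : ℝ) :
    Matrix (Fin n) (Fin n) ℂ :=
  mpow A (1/2) * mpow (mpow A (-(1/2)) * B * mpow A (-(1/2))) t * mpow A (1/2)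

/-- Eigenvalues of a Hermitian matrix in decreasing order. -/
noncomputable def eigsDesc {n : ℕ} (M : Matrix (Fin n) (Fin n) ℂ) : Fin n → ℝ :=
  if hM : M.IsHermitian then fun i => hM.eigenvalues (Tuple.sort hM.eigenvalues (Fin.rev i))
  else 0


/-- The matrix `U diag(f) Uᴴ`. -/
noncomputable def conjDiagonal {n : ℕ} (U : Matrix (Fin n) (Fin n) ℂ) (f : Fin n → ℝ) :
    Matrix (Fin n) (Fin n) ℂ :=
  U * diagonal (fun i => (f i : ℂ)) * Uᴴ

lemma conjDiagonal_isHermitian {n : ℕ} (U : Matrix (Fin n) (Fin n) ℂ) (f : Fin n → ℝ) :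
    (conjDiagonal U f).IsHermitian := by
  apply isHermitian_mul_mul_conjTranspose
  ext i j
  by_cases h : i = j
  · subst h; simp
  · simp [h, Ne.symm h]

lemma conjDiagonal_mul {n : ℕ} {U : Matrix (Fin n) (Fin n) ℂ} (hU : Uᴴ * U = 1)
    (f g : Fin n → ℝ) :
    conjDiagonal U f * conjDiagonal U g = conjDiagonal U (fun i => f i * g i) := by
  have : conjDiagonal U f * conjDiagonal U g = U * diagonal (fun i => (f i : ℂ)) * (Uᴴ * U) *
      diagonal (fun i => (g i : ℂ)) * Uᴴ := by
    simp only [conjDiagonal, Matrix.mul_assoc]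
  rw [this, hU, Matrix.mul_one, Matrix.mul_assoc U, diagonal_mul_diagonal]
  simp [conjDiagonal]

lemma conjDiagonal_one {n : ℕ} {U : Matrix (Fin n) (Fin n) ℂ} (hU : Uᴴ * U = 1) :
    conjDiagonal U (fun _ => 1) = 1 := by
  simp [conjDiagonal, mul_eq_one_comm.1 hU]

lemma conjDiagonal_add {n : ℕ} (U : Matrix (Fin n) (Fin n) ℂ) (f g : Fin n → ℝ) :
    conjDiagonal U f + conjDiagonal U g = conjDiagonal U (fun i => f i + g i) := by
  simp [conjDiagonal, ← Matrix.mul_add, ← Matrix.add_mul]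

lemma conjDiagonal_smul {n : ℕ} (U : Matrix (Fin n) (Fin n) ℂ) (r : ℝ) (f : Fin n → ℝ) :
    (r : ℂ) • conjDiagonal U f = conjDiagonal U (fun i => r * f i) := by
  have : diagonal (fun i => ((r * f i : ℝ) : ℂ)) = (r : ℂ) • diagonal (fun i => (f i : ℂ)) := by
    rw [← diagonal_smul]; congr 1; ext i; simp
  rw [conjDiagonal, conjDiagonal, this, Matrix.mul_smul, Matrix.smul_mul]

lemma Matrix.PosDef.exists_conjDiagonal {n : ℕ} {A : Matrix (Fin n) (Fin n) ℂ} (hA : A.PosDef) :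
    ∃ (U : Matrix (Fin n) (Fin n) ℂ) (a : Fin n → ℝ), Uᴴ * U = 1 ∧ (∀ i, 0 < a i) ∧
      A = conjDiagonal U a ∧ ∀ r, mpow A r = conjDiagonal U (fun i => a i ^ r) := by
  refine ⟨hA.1.eigenvectorUnitary, hA.1.eigenvalues, ?_, hA.eigenvalues_pos, ?_, fun r => ?_⟩
  · exact Unitary.coe_star_mul_self hA.1.eigenvectorUnitary
  · exact hA.1.spectral_theorem
  · rw [mpow, dif_pos hA.1]; rfl

lemma trace_diagonal_mul_mul_diagonal_mul_conjTranspose {n : ℕ} (X : Matrix (Fin n) (Fin n) ℂ)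
    (f g : Fin n → ℝ) :
    (diagonal (fun i => (f i : ℂ)) * X * diagonal (fun i => (g i : ℂ)) * Xᴴ).trace =
      ((∑ i, ∑ j, f i * g j * Complex.normSq (X i j) : ℝ) : ℂ) := by
  simp only [trace, diag_apply]
  push_cast
  refine Finset.sum_congr rfl fun i _ => ?_
  rw [mul_apply]
  refine Finset.sum_congr rfl fun j _ => ?_
  rw [mul_diagonal, diagonal_mul, conjTranspose_apply, Complex.normSq_eq_conj_mul_self]
  simp only [RCLike.star_def]
  ring

lemma trace_conjDiagonal_mul_conjDiagonal {n : ℕ} (U V : Matrix (Fin n) (Fin n) ℂ)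
    (f g : Fin n → ℝ) :
    (conjDiagonal U f * conjDiagonal V g).trace =
      ((∑ i, ∑ j, f i * g j * Complex.normSq ((Uᴴ * V) i j) : ℝ) : ℂ) := by
  rw [← trace_diagonal_mul_mul_diagonal_mul_conjTranspose, conjDiagonal, conjDiagonal,
    Matrix.mul_assoc U, Matrix.mul_assoc U, trace_mul_comm]
  simp only [conjTranspose_mul, conjTranspose_conjTranspose, Matrix.mul_assoc]

lemma trace_mul_conjDiagonal_mul_mul_conjDiagonal {n : ℕ} {A : Matrix (Fin n) (Fin n) ℂ}
    (hA : A.IsHermitian) (W : Matrix (Fin n) (Fin n) ℂ) (f g : Fin n → ℝ) :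
    (A * conjDiagonal W f * A * conjDiagonal W g).trace =
      ((∑ i, ∑ j, f i * g j * Complex.normSq ((Wᴴ * A * W) i j) : ℝ) : ℂ) := by
  rw [← trace_diagonal_mul_mul_diagonal_mul_conjTranspose]
  have : A * conjDiagonal W f * A * conjDiagonal W g = A * W *
      (diagonal (fun i => (f i : ℂ)) * Wᴴ * A * W * diagonal (fun i => (g i : ℂ)) * Wᴴ) := by
    simp only [conjDiagonal, Matrix.mul_assoc]
  rw [this, trace_mul_comm]
  simp only [conjTranspose_mul, conjTranspose_conjTranspose, Matrix.mul_assoc, hA.eq]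

/-- If `G` is the inverse of `diag(s) + u diag(b) uᴴ`, then the trace of `G` against a weight
decreasing in `s` is at most the same expression computed as if the summands commuted. -/
lemma sum_mul_diag_inv_le {n : ℕ} {G u : Matrix (Fin n) (Fin n) ℂ} {s b w : Fin n → ℝ}
    (hu : uᴴ * u = 1) (hG : G.IsHermitian) (hs : ∀ j, 0 < s j) (hb : ∀ j, 0 < b j)
    (hw : ∀ j, 0 ≤ w j) (hsw : ∀ j k, 0 ≤ (w j - w k) * (s k - s j))
    (hinv : G * (diagonal (fun i => (s i : ℂ)) + conjDiagonal u b) = 1) :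
    ∑ j, w j * (G j j).re ≤ ∑ j, ∑ k, w j * (1 / (s j + b k) * Complex.normSq (u j k)) := by
  have diag_le (j : Fin n) : (G j j).re + ∑ k, (s k - s j) * Complex.normSq (G j k) ≤
      ∑ k, 1 / (s j + b k) * Complex.normSq (u j k) := by
    set M := conjDiagonal u (fun k => s j + b k)
    set N := conjDiagonal u (fun k => 1 / (s j + b k))
    have hMN : M * N = 1 := by
      rw [conjDiagonal_mul hu, ← conjDiagonal_one hu]
      congr 1; ext k
      have := hs j; have := hb k
      field_simp
    have hNM : N * M = 1 := mul_eq_one_comm.1 hMN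
    have hN : N.PosSemidef := by
      refine PosSemidef.mul_mul_conjTranspose_same (PosSemidef.diagonal fun k => ?_) u
      have := hs j; have := hb k
      simp only [Pi.zero_apply]
      exact_mod_cast (by positivity : (0 : ℝ) ≤ 1 / (s j + b k))
    have hMH : Mᴴ = M := conjDiagonal_isHermitian u _
    have hM : M = diagonal (fun i => (s i : ℂ)) + conjDiagonal u b -
        diagonal (fun i => ((s i - s j : ℝ) : ℂ)) := by
      have h1 : conjDiagonal u (fun _ => s j) = diagonal (fun _ => (s j : ℂ)) := by
        have := conjDiagonal_smul u (s j) (fun _ => 1)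
        rw [conjDiagonal_one hu] at this
        simp only [mul_one] at this
        rw [← this, smul_one_eq_diagonal]
      have h2 : M = conjDiagonal u (fun _ => s j) + conjDiagonal u b :=
        (conjDiagonal_add u _ _).symm
      rw [h2, h1, add_sub_right_comm, diagonal_sub]
      simp
    have key := (hN.mul_mul_conjTranspose_same (1 - G * M)).diag_nonneg (i := j)
    have hexp : (1 - G * M) * N * (1 - G * M)ᴴ = N - G -
        G * diagonal (fun i => ((s i - s j : ℝ) : ℂ)) * Gᴴ := by
      rw [conjTranspose_sub, conjTranspose_one, conjTranspose_mul, hG.eq, hMH]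
      have h1 : (1 - G * M) * N * (1 - M * G) = N - G * (M * N) - (N * M) * G +
          G * (M * N) * M * G := by noncomm_ring
      rw [h1, hMN, hNM, Matrix.mul_one, Matrix.one_mul, hM, Matrix.mul_sub, hinv]
      noncomm_ring
    rw [hexp, Matrix.sub_apply, Matrix.sub_apply] at key
    have hNj : N j j = ((∑ k, 1 / (s j + b k) * Complex.normSq (u j k) : ℝ) : ℂ) := by
      simp only [N, conjDiagonal]
      rw [mul_apply]
      push_cast
      refine Finset.sum_congr rfl fun k _ => ?_
      rw [mul_diagonal, conjTranspose_apply, Complex.normSq_eq_conj_mul_self]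
      simp only [RCLike.star_def]
      ring
    have hGj : (G * diagonal (fun i => ((s i - s j : ℝ) : ℂ)) * Gᴴ) j j =
        ((∑ k, (s k - s j) * Complex.normSq (G j k) : ℝ) : ℂ) := by
      rw [mul_apply]
      push_cast
      refine Finset.sum_congr rfl fun k _ => ?_
      rw [mul_diagonal, conjTranspose_apply, Complex.normSq_eq_conj_mul_self]
      simp only [RCLike.star_def]
      ring
    rw [hNj, hGj] at key
    have := (Complex.le_def.1 key).1
    simp only [Complex.sub_re, Complex.ofReal_re, Complex.zero_re] at this
    linarith
  have hsum : 0 ≤ ∑ j, ∑ k, w j * ((s k - s j) * Complex.normSq (G j k)) := by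
    have hsymm (j k : Fin n) : Complex.normSq (G j k) = Complex.normSq (G k j) := by
      rw [← hG.apply j k]; simp
    have hswap : ∑ j, ∑ k, w j * ((s k - s j) * Complex.normSq (G j k)) =
        ∑ j, ∑ k, -(w k * ((s k - s j) * Complex.normSq (G j k))) := by
      rw [Finset.sum_comm]
      refine Finset.sum_congr rfl fun j _ => Finset.sum_congr rfl fun k _ => ?_
      rw [hsymm k j]; ring
    have hadd : 0 ≤ ∑ j, ∑ k, w j * ((s k - s j) * Complex.normSq (G j k)) +
        ∑ j, ∑ k, -(w k * ((s k - s j) * Complex.normSq (G j k))) := by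
      simp only [← Finset.sum_add_distrib]
      refine Finset.sum_nonneg fun j _ => Finset.sum_nonneg fun k _ => ?_
      have := mul_nonneg (hsw j k) (Complex.normSq_nonneg (G j k))
      linarith
    linarith
  calc ∑ j, w j * (G j j).re
      ≤ ∑ j, w j * (G j j).re + ∑ j, ∑ k, w j * ((s k - s j) * Complex.normSq (G j k)) := by
        linarith
    _ = ∑ j, w j * ((G j j).re + ∑ k, (s k - s j) * Complex.normSq (G j k)) := by
        simp only [mul_add, Finset.sum_add_distrib, Finset.mul_sum]
    _ ≤ ∑ j, w j * ∑ k, 1 / (s j + b k) * Complex.normSq (u j k) :=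
        Finset.sum_le_sum fun j _ => mul_le_mul_of_nonneg_left (diag_le j) (hw j)
    _ = _ := by simp only [Finset.mul_sum]

lemma trace_conjDiagonal_mul_inv_le {n : ℕ} {H U V : Matrix (Fin n) (Fin n) ℂ} {a b : Fin n → ℝ}
    {l : ℝ} (hU : Uᴴ * U = 1) (hV : Vᴴ * V = 1) (ha : ∀ i, 0 < a i) (hb : ∀ i, 0 < b i)
    (hl : 0 < l) (hH : H.IsHermitian)
    (hinv : H * (conjDiagonal U (fun i => (a i)⁻¹) + (l : ℂ) • conjDiagonal V (fun i => (b i)⁻¹))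
      = 1) :
    (conjDiagonal U a * H).trace.re ≤
      ∑ j, ∑ k, a j ^ 2 * Complex.normSq ((Uᴴ * V) j k) * (b k / a j) / (b k / a j + l) := by
  have hU' : U * Uᴴ = 1 := mul_eq_one_comm.1 hU
  have htr : (conjDiagonal U a * H).trace.re = ∑ j, a j * ((Uᴴ * H * U) j j).re := by
    rw [conjDiagonal, Matrix.mul_assoc, Matrix.mul_assoc, trace_mul_comm, Matrix.mul_assoc, trace]
    simp [diagonal_mul]
  have hinv' : Uᴴ * H * U * (diagonal (fun i => (((a i)⁻¹ : ℝ) : ℂ)) +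
      conjDiagonal (Uᴴ * V) (fun i => l * (b i)⁻¹)) = 1 := by
    have h1 : diagonal (fun i => (((a i)⁻¹ : ℝ) : ℂ)) =
        Uᴴ * conjDiagonal U (fun i => (a i)⁻¹) * U := by
      rw [conjDiagonal]
      calc _ = (Uᴴ * U) * diagonal (fun i => (((a i)⁻¹ : ℝ) : ℂ)) * (Uᴴ * U) := by simp [hU]
        _ = _ := by simp only [Matrix.mul_assoc]
    have h2 : conjDiagonal (Uᴴ * V) (fun i => l * (b i)⁻¹) =
        Uᴴ * ((l : ℂ) • conjDiagonal V (fun i => (b i)⁻¹)) * U := by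
      rw [conjDiagonal_smul]
      simp only [conjDiagonal, conjTranspose_mul, conjTranspose_conjTranspose, Matrix.mul_assoc]
    rw [h1, h2, ← Matrix.add_mul, ← Matrix.mul_add]
    generalize conjDiagonal U (fun i => (a i)⁻¹) + (l : ℂ) • conjDiagonal V (fun i => (b i)⁻¹) = K
      at hinv
    calc Uᴴ * H * U * (Uᴴ * K * U) = Uᴴ * H * (U * Uᴴ) * K * U := by simp only [Matrix.mul_assoc]
      _ = Uᴴ * (H * K) * U := by rw [hU', Matrix.mul_one, Matrix.mul_assoc Uᴴ]
      _ = 1 := by rw [hinv, Matrix.mul_one, hU]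
  have hu : (Uᴴ * V)ᴴ * (Uᴴ * V) = 1 := by
    rw [conjTranspose_mul, conjTranspose_conjTranspose, Matrix.mul_assoc, ← Matrix.mul_assoc U, hU',
      Matrix.one_mul, hV]
  rw [htr]
  refine (sum_mul_diag_inv_le hu (isHermitian_conjTranspose_mul_mul U hH)
    (fun j => inv_pos.2 (ha j)) (fun j => mul_pos hl (inv_pos.2 (hb j))) (fun j => (ha j).le)
    (fun j k => ?_) hinv').trans_eq ?_
  · have hj := ha j
    have hk := ha k
    have : (a j - a k) * ((a k)⁻¹ - (a j)⁻¹) = (a j - a k) ^ 2 / (a j * a k) := by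
      field_simp
    rw [this]
    positivity
  · refine Finset.sum_congr rfl fun j _ => Finset.sum_congr rfl fun k _ => ?_
    have hj := ha j
    have hk := hb k
    field_simp

open MeasureTheory Set in
/-- Inequalities between mixtures of the functions `x ↦ x / (x + l)` pass to `x ↦ x ^ p`. -/
lemma sum_mul_rpow_le_sum_mul_rpow {ι κ : Type*} [Fintype ι] [Fintype κ] {w x : ι → ℝ}
    {v y : κ → ℝ} (hx : ∀ i, 0 < x i) (hy : ∀ k, 0 < y k)
    (h : ∀ l, 0 < l → ∑ i, w i * x i / (x i + l) ≤ ∑ k, v k * y k / (y k + l))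
    {p : ℝ} (hp : p ∈ Icc (0 : ℝ) 1) :
    ∑ i, w i * x i ^ p ≤ ∑ k, v k * y k ^ p := by
  have hIoo : ∀ q ∈ Ioo (0 : ℝ) 1, ∑ i, w i * x i ^ q ≤ ∑ k, v k * y k ^ q := by
    intro q hq
    have hint : ∀ z : ℝ, 0 < z → IntegrableOn (Real.rpowIntegrand₀₁ q · z) (Ioi 0) :=
      fun z hz => Real.integrableOn_rpowIntegrand₀₁_Ioi hq hz.le
    have hle : ∫ l in Ioi (0 : ℝ), ∑ i, w i * Real.rpowIntegrand₀₁ q l (x i) ≤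
        ∫ l in Ioi (0 : ℝ), ∑ k, v k * Real.rpowIntegrand₀₁ q l (y k) := by
      refine setIntegral_mono_on (integrable_finsetSum _ fun i _ => (hint _ (hx i)).const_mul _)
        (integrable_finsetSum _ fun k _ => (hint _ (hy k)).const_mul _) measurableSet_Ioi
        fun l hl => ?_
      have hl' : 0 < l := hl
      have := mul_le_mul_of_nonneg_left (h l hl') (Real.rpow_nonneg hl'.le (q - 1))
      rw [Finset.mul_sum, Finset.mul_sum] at this
      convert this using 2 with i _ k _
      · rw [Real.rpowIntegrand₀₁_eq_pow_div hq hl'.le (hx i).le, add_comm (x i)]; ring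
      · rename_i k _
        rw [Real.rpowIntegrand₀₁_eq_pow_div hq hl'.le (hy k).le, add_comm (y k)]; ring
    rw [integral_finsetSum _ fun i _ => (hint _ (hx i)).const_mul _,
      integral_finsetSum _ fun k _ => (hint _ (hy k)).const_mul _] at hle
    simp only [integral_const_mul, Real.integral_rpowIntegrand₀₁_eq_rpow_mul_const hq (hx _).le,
      Real.integral_rpowIntegrand₀₁_eq_rpow_mul_const hq (hy _).le, ← mul_assoc,
      ← Finset.sum_mul] at hle
    exact le_of_mul_le_mul_right hle (Real.integral_rpowIntegrand₀₁_one_pos hq)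
  have hclosed : IsClosed {q : ℝ | ∑ i, w i * x i ^ q ≤ ∑ k, v k * y k ^ q} := by
    refine isClosed_le ?_ ?_
    · exact continuous_finsetSum _ fun i _ =>
        continuous_const.mul (Real.continuous_const_rpow (hx i).ne')
    · exact continuous_finsetSum _ fun k _ =>
        continuous_const.mul (Real.continuous_const_rpow (hy k).ne')
  have := closure_minimal (s := Ioo (0 : ℝ) 1) hIoo hclosed
  rw [closure_Ioo zero_ne_one] at this
  exact this hp

lemma trace_geomMean_sq_le {n : ℕ} {A B : Matrix (Fin n) (Fin n) ℂ}
    (hA : A.PosDef) (hB : B.PosDef) {t : ℝ} (ht : t ∈ Set.Icc (0 : ℝ) 1) :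
    ((geomMean A B t) ^ 2).trace ≤ (mpow B (2 * t) * mpow A (2 * (1 - t))).trace := by
  obtain ⟨U, a, hU, ha, hAU, hApow⟩ := hA.exists_conjDiagonal
  obtain ⟨V, b, hV, hb, hBV, hBpow⟩ := hB.exists_conjDiagonal
  set P := mpow A (1 / 2) with hP
  set R := mpow A (-(1 / 2)) with hR
  have hPH : P.IsHermitian := by rw [hP, hApow]; exact conjDiagonal_isHermitian _ _
  have hRH : R.IsHermitian := by rw [hR, hApow]; exact conjDiagonal_isHermitian _ _
  have hPP : P * P = A := by
    rw [hP, hApow, conjDiagonal_mul hU]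
    conv_rhs => rw [hAU]
    congr 1; ext i
    rw [← Real.rpow_add (ha i)]; norm_num
  have hPR : P * R = 1 := by
    rw [hP, hR, hApow, hApow, conjDiagonal_mul hU, ← conjDiagonal_one hU]
    congr 1; ext i
    rw [← Real.rpow_add (ha i)]; norm_num
  have hRP : R * P = 1 := mul_eq_one_comm.1 hPR
  have hRR : R * R = conjDiagonal U (fun i => (a i)⁻¹) := by
    rw [hR, hApow, conjDiagonal_mul hU]
    congr 1; ext i
    rw [← Real.rpow_add (ha i), ← Real.rpow_neg_one]; norm_num
  have hC : (R * B * R).PosDef := by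
    have hinj : Function.Injective R.vecMul := fun x y hxy => by
      have := congrArg (fun z => z ᵥ* P) hxy
      simpa [vecMul_vecMul, hRP] using this
    have := hB.mul_mul_conjTranspose_same hinj
    rwa [hRH.eq] at this
  obtain ⟨W, c, hW, hc, hCW, hCpow⟩ := hC.exists_conjDiagonal
  have hBC : P * conjDiagonal W c * P = B := by
    rw [← hCW]
    calc P * (R * B * R) * P = (P * R) * B * (R * P) := by simp only [Matrix.mul_assoc]
      _ = B := by rw [hPR, hRP, Matrix.one_mul, Matrix.mul_one]
  have hBinv : R * conjDiagonal W (fun i => (c i)⁻¹) * R = conjDiagonal V (fun i => (b i)⁻¹) := by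
    have h1 : B * (R * conjDiagonal W (fun i => (c i)⁻¹) * R) = 1 := by
      rw [← hBC]
      calc _ = P * conjDiagonal W c * (P * R) * conjDiagonal W (fun i => (c i)⁻¹) * R := by
            simp only [Matrix.mul_assoc]
        _ = P * (conjDiagonal W c * conjDiagonal W (fun i => (c i)⁻¹)) * R := by
            rw [hPR, Matrix.mul_one, Matrix.mul_assoc P]
        _ = 1 := by
            rw [conjDiagonal_mul hW]
            simp only [mul_inv_cancel₀ (hc _).ne']
            rw [conjDiagonal_one hW, Matrix.mul_one, hPR]
    have h2 : B * conjDiagonal V (fun i => (b i)⁻¹) = 1 := by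
      conv_lhs => rw [hBV]
      rw [conjDiagonal_mul hV]
      simp only [mul_inv_cancel₀ (hb _).ne']
      exact conjDiagonal_one hV
    rw [← inv_eq_right_inv h1, inv_eq_right_inv h2]
  -- the weighted parallel sums of `A` and `B`
  have hH (μ ν : ℝ) (hμ : 0 < μ) (hν : 0 < ν) :
      P * conjDiagonal W (fun i => c i / (μ * c i + ν)) * P *
        ((μ : ℂ) • conjDiagonal U (fun i => (a i)⁻¹) +
          (ν : ℂ) • conjDiagonal V (fun i => (b i)⁻¹)) = 1 := by
    have h1 : (μ : ℂ) • conjDiagonal U (fun i => (a i)⁻¹) +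
        (ν : ℂ) • conjDiagonal V (fun i => (b i)⁻¹) =
        R * conjDiagonal W (fun i => μ * 1 + ν * (c i)⁻¹) * R := by
      rw [← conjDiagonal_add, ← conjDiagonal_smul, ← conjDiagonal_smul, conjDiagonal_one hW,
        ← hBinv, ← hRR]
      simp [Matrix.mul_add, Matrix.add_mul]
    rw [h1]
    calc _ = P * conjDiagonal W (fun i => c i / (μ * c i + ν)) * (P * R) *
          conjDiagonal W (fun i => μ * 1 + ν * (c i)⁻¹) * R := by simp only [Matrix.mul_assoc]
      _ = P * (conjDiagonal W (fun i => c i / (μ * c i + ν)) *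
          conjDiagonal W (fun i => μ * 1 + ν * (c i)⁻¹)) * R := by
          rw [hPR, Matrix.mul_one, Matrix.mul_assoc P]
      _ = P * conjDiagonal W (fun _ => 1) * R := by
          rw [conjDiagonal_mul hW]
          congr 3; ext i
          have := hc i
          field_simp
      _ = 1 := by rw [conjDiagonal_one hW, Matrix.mul_one, hPR]
  have hHH (f : Fin n → ℝ) : (P * conjDiagonal W f * P).IsHermitian := by
    have := isHermitian_mul_mul_conjTranspose P (conjDiagonal_isHermitian W f)
    rwa [hPH.eq] at this
  have htrace (f g : Fin n → ℝ) :
      ((P * conjDiagonal W f * P) * (P * conjDiagonal W g * P)).trace =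
        ((∑ i, ∑ j, f i * g j * Complex.normSq ((Wᴴ * A * W) i j) : ℝ) : ℂ) := by
    rw [← trace_mul_conjDiagonal_mul_mul_conjDiagonal hA.1, ← hPP]
    simp only [← Matrix.mul_assoc]
    rw [trace_mul_comm _ P]
    simp only [← Matrix.mul_assoc]
  set N : Fin n → Fin n → ℝ := fun i j => Complex.normSq ((Wᴴ * A * W) i j) with hN
  have hN0 (i j) : 0 ≤ N i j := Complex.normSq_nonneg _
  have hNsymm (i j) : N i j = N j i := by
    have := (isHermitian_conjTranspose_mul_mul W hA.1).apply i j
    simp only [hN]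
    rw [← this]; simp
  have hsymm_le (f : Fin n → Fin n → ℝ) (g : Fin n → Fin n → ℝ)
      (hfg : ∀ i j, 2 * f i j ≤ g i j + g j i) :
      ∑ i, ∑ j, f i j * N i j ≤ ∑ i, ∑ j, g i j * N i j := by
    have h1 : ∑ i, ∑ j, g i j * N i j = ∑ i, ∑ j, g j i * N i j := by
      rw [Finset.sum_comm]
      exact Finset.sum_congr rfl fun i _ => Finset.sum_congr rfl fun j _ => by rw [hNsymm i j]
    have h2 : ∑ i, ∑ j, 2 * (f i j * N i j) ≤
        ∑ i, ∑ j, g i j * N i j + ∑ i, ∑ j, g j i * N i j := by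
      simp only [← Finset.sum_add_distrib]
      refine Finset.sum_le_sum fun i _ => Finset.sum_le_sum fun j _ => ?_
      have := mul_le_mul_of_nonneg_right (hfg i j) (hN0 i j)
      linarith
    simp only [← Finset.mul_sum] at h2
    linarith
  have hsq (x y : ℝ) (hx : 0 < x) (hy : 0 < y) : 2 * (x ^ t * y ^ t) ≤
      x ^ (2 * t) + y ^ (2 * t) := by
    rw [mul_comm 2 t, Real.rpow_mul hx.le, Real.rpow_mul hy.le, Real.rpow_two, Real.rpow_two]
    nlinarith [sq_nonneg (x ^ t - y ^ t)]
  have hL : ((geomMean A B t) ^ 2).trace = ((∑ i, ∑ j, c i ^ t * c j ^ t * N i j : ℝ) : ℂ) := by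
    rw [← htrace, geomMean, ← hP, ← hR, hCpow, sq]
  rw [hL, trace_mul_comm, hApow, hBpow, trace_conjDiagonal_mul_conjDiagonal]
  refine Complex.real_le_real.2 ?_
  rcases le_total t (1 / 2) with h | h
  · calc ∑ i, ∑ j, c i ^ t * c j ^ t * N i j
        ≤ ∑ i, ∑ j, c j ^ (2 * t) * N i j :=
          hsymm_le (fun i j => c i ^ t * c j ^ t) (fun i j => c j ^ (2 * t)) fun i j => by
            linarith [hsq _ _ (hc i) (hc j)]
      _ = ∑ j, (∑ i, N i j) * c j ^ (2 * t) := by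
          rw [Finset.sum_comm]
          simp only [mul_comm (c _ ^ (2 * t)), Finset.sum_mul]
      _ ≤ ∑ q : Fin n × Fin n, (a q.1 ^ 2 * Complex.normSq ((Uᴴ * V) q.1 q.2)) *
            (b q.2 / a q.1) ^ (2 * t) := by
          refine sum_mul_rpow_le_sum_mul_rpow hc (fun q => div_pos (hb _) (ha _)) (fun l hl => ?_)
            ⟨by linarith [ht.1], by linarith⟩
          have hinv := hH 1 l one_pos hl
          rw [Complex.ofReal_one, one_smul] at hinv
          have key := trace_conjDiagonal_mul_inv_le hU hV ha hb hl (hHH _) hinv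
          have hA1 : conjDiagonal U a = P * conjDiagonal W (fun _ => 1) * P := by
            rw [conjDiagonal_one hW, Matrix.mul_one, hPP, hAU]
          rw [hA1, htrace, Complex.ofReal_re, ← Fintype.sum_prod_type', Fintype.sum_prod_type,
            Finset.sum_comm] at key
          rw [Fintype.sum_prod_type]
          refine le_of_eq_of_le ?_ key
          refine Finset.sum_congr rfl fun j _ => ?_
          rw [mul_div_assoc, Finset.sum_mul]
          refine Finset.sum_congr rfl fun i _ => ?_
          simp only [hN]; ring
      _ = _ := by
          rw [Fintype.sum_prod_type]
          refine Finset.sum_congr rfl fun j _ => Finset.sum_congr rfl fun k _ => ?_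
          have : a j ^ (2 * (1 - t)) = a j ^ 2 / a j ^ (2 * t) := by
            rw [← Real.rpow_two, ← Real.rpow_sub (ha j)]; ring_nf
          simp only
          rw [Real.div_rpow (hb k).le (ha j).le, this]
          ring
  · calc ∑ i, ∑ j, c i ^ t * c j ^ t * N i j
        ≤ ∑ i, ∑ j, (c i * c j * (c j)⁻¹ ^ (2 * (1 - t))) * N i j :=
          hsymm_le (fun i j => c i ^ t * c j ^ t)
            (fun i j => c i * c j * (c j)⁻¹ ^ (2 * (1 - t))) fun i j => by
            have hc' (x : ℝ) (hx : 0 < x) : x⁻¹ ^ (2 * (1 - t)) = (x ^ (t - 1)) ^ 2 := by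
              rw [Real.inv_rpow hx.le, ← Real.rpow_neg hx.le, ← Real.rpow_natCast,
                ← Real.rpow_mul hx.le]
              congr 1; push_cast; ring
            have hct (x : ℝ) (hx : 0 < x) : x ^ t = x * x ^ (t - 1) := by
              rw [Real.rpow_sub hx, Real.rpow_one]; field_simp
            rw [hc' _ (hc i), hc' _ (hc j), hct _ (hc i), hct _ (hc j)]
            nlinarith [mul_nonneg (mul_pos (hc i) (hc j)).le
              (sq_nonneg (c i ^ (t - 1) - c j ^ (t - 1)))]
      _ = ∑ j, (∑ i, c i * c j * N i j) * (c j)⁻¹ ^ (2 * (1 - t)) := by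
          rw [Finset.sum_comm]
          simp only [Finset.sum_mul]
          exact Finset.sum_congr rfl fun j _ => Finset.sum_congr rfl fun i _ => by ring
      _ ≤ ∑ q : Fin n × Fin n, (b q.1 ^ 2 * Complex.normSq ((Vᴴ * U) q.1 q.2)) *
            (a q.2 / b q.1) ^ (2 * (1 - t)) := by
          refine sum_mul_rpow_le_sum_mul_rpow (fun j => inv_pos.2 (hc j))
            (fun q => div_pos (ha _) (hb _)) (fun l hl => ?_)
            ⟨by linarith [ht.2], by linarith⟩
          have hinv := hH l 1 hl one_pos
          rw [Complex.ofReal_one, one_smul, add_comm] at hinv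
          have key := trace_conjDiagonal_mul_inv_le hV hU hb ha hl (hHH _) hinv
          rw [← hBV, ← hBC, htrace, Complex.ofReal_re, Finset.sum_comm] at key
          rw [Fintype.sum_prod_type]
          refine le_of_eq_of_le ?_ key
          refine Finset.sum_congr rfl fun j _ => ?_
          rw [mul_div_assoc, Finset.sum_mul]
          refine Finset.sum_congr rfl fun i _ => ?_
          have := hc j
          simp only [hN]
          field_simp
          ring
      _ = _ := by
          rw [Fintype.sum_prod_type, Finset.sum_comm]
          refine Finset.sum_congr rfl fun j _ => Finset.sum_congr rfl fun k _ => ?_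
          have h1 : b k ^ (2 * t) = b k ^ 2 / b k ^ (2 * (1 - t)) := by
            rw [← Real.rpow_two, ← Real.rpow_sub (hb k)]; ring_nf
          have h2 : Complex.normSq ((Vᴴ * U) k j) = Complex.normSq ((Uᴴ * V) j k) := by
            have : Vᴴ * U = (Uᴴ * V)ᴴ := by simp
            rw [this, conjTranspose_apply]; simp
          simp only
          rw [Real.div_rpow (ha j).le (hb k).le, h1, h2]
          ring

/-- `Tr((A♯ₜB)² + (A♯₁₋ₜB)²) ≤ Tr(A^{2t}B^{2(1-t)} + B^{2t}A^{2(1-t)})`. -/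
theorem stmt_10 {n : ℕ} (A B : Matrix (Fin n) (Fin n) ℂ)
    (hA : A.PosDef) (hB : B.PosDef) (t : ℝ) (ht : t ∈ Set.Icc (0:ℝ) 1) :
    ((geomMean A B t) ^ 2 + (geomMean A B (1 - t)) ^ 2).trace ≤
      (mpow A (2 * t) * mpow B (2 * (1 - t)) + mpow B (2 * t) * mpow A (2 * (1 - t))).trace := by
  rw [trace_add, trace_add, add_comm (mpow A (2 * t) * mpow B (2 * (1 - t))).trace,
    trace_mul_comm (mpow A (2 * t))]
  refine add_le_add (trace_geomMean_sq_le hA hB ht) ?_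
  have := trace_geomMean_sq_le hA hB (t := 1 - t) ⟨by linarith [ht.2], by linarith [ht.1]⟩
  rwa [sub_sub_cancel] at this
end

section
/- Let A and B be n×n positive definite complex matrices and t ∈ [0,1]. Then Tr((A + B)(A♯_t B + A♯_{1−t} B)) ≤ Tr(A^{t+1} B^{1−t} + A^{2−t} B^t + A^t B^{2−t} + A^{1−t} B^{1+t}). -/
open Matrix ComplexOrder

section ResolventComparison

variable {ι : Type*} [Fintype ι] [DecidableEq ι]

lemma star_mulVec_dotProduct_mulVec_of_unitary {V : Matrix ι ι ℂ} (hV : V * Vᴴ = 1)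
    (x y : ι → ℂ) : star (Vᴴ *ᵥ x) ⬝ᵥ (Vᴴ *ᵥ y) = star x ⬝ᵥ y := by
  rw [star_mulVec, conjTranspose_conjTranspose, ← dotProduct_mulVec, mulVec_mulVec, hV, one_mulVec]

lemma re_mul_ge_of_mul_eq_add {c a : ℝ} (ha : 0 < a) (hac : a ≤ c) {v h d : ℂ}
    (hv : (c : ℂ) * h = star v + d) :
    Complex.normSq v / c + (star h * d).re - Complex.normSq d / a ≤ (v * h).re := by
  have hc : 0 < c := ha.trans_le hac
  have h1 : v.re = c * h.re - d.re := by
    have := congrArg Complex.re hv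
    simp at this
    linarith
  have h2 : v.im = d.im - c * h.im := by
    have := congrArg Complex.im hv
    simp at this
    linarith
  have h3 : Complex.normSq d / c ≤ Complex.normSq d / a :=
    div_le_div_of_nonneg_left (Complex.normSq_nonneg d) ha hac
  have h4 : Complex.normSq v / c + (star h * d).re - Complex.normSq d / c = (v * h).re := by
    simp only [Complex.normSq_apply, Complex.mul_re, Complex.star_def, Complex.conj_re,
      Complex.conj_im, h1, h2]
    field_simp
    ring
  linarith

/-- Comparison of the diagonal of the resolvent `(a + B)⁻¹` for a diagonal matrix `a` with the
scalar resolvents `(aᵢ + B)⁻¹`. -/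
lemma sum_div_add_normSq_le_re_diag {a b : ι → ℝ} (ha : ∀ i, 0 < a i) (hb : ∀ k, 0 ≤ b k)
    {V G : Matrix ι ι ℂ} (hV : V * Vᴴ = 1)
    (hG : (diagonal (fun i => (a i : ℂ)) + V * diagonal (fun k => (b k : ℂ)) * Vᴴ) * G = 1)
    (i : ι) :
    ∑ k, Complex.normSq (V i k) / (a i + b k) +
      ∑ j, ((a i - a j) - (a i - a j) ^ 2 / a i) * Complex.normSq (G j i) ≤ (G i i).re := by
  have hV' : Vᴴ * V = 1 := mul_eq_one_comm.mp hV
  set g : ι → ℂ := fun j => G j i with hg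
  set y : ι → ℂ := fun j => ((a i - a j : ℝ) : ℂ) * G j i with hy
  have hGV : G = V * (Vᴴ * G) := by rw [← Matrix.mul_assoc, hV, Matrix.one_mul]
  have hGi : G i i = ∑ k, V i k * (Vᴴ *ᵥ g) k := by
    conv_lhs => rw [hGV]
    rfl
  have key : Vᴴ * (diagonal (fun i => (a i : ℂ)) * G) +
      diagonal (fun k => (b k : ℂ)) * (Vᴴ * G) = Vᴴ := by
    have := congrArg (Vᴴ * ·) hG
    simp only [Matrix.mul_one, Matrix.add_mul, Matrix.mul_add] at this
    refine Eq.trans ?_ this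
    congr 1
    simp only [← Matrix.mul_assoc, hV', Matrix.one_mul]
  have hk : ∀ k, ((a i + b k : ℝ) : ℂ) * (Vᴴ *ᵥ g) k = star (V i k) + (Vᴴ *ᵥ y) k := by
    intro k
    have h1 := congrFun (congrFun key k) i
    rw [Matrix.add_apply, diagonal_mul, Matrix.mul_apply] at h1
    simp only [diagonal_mul, conjTranspose_apply] at h1
    have h2 : (Vᴴ *ᵥ y) k = (a i : ℂ) * (Vᴴ *ᵥ g) k - ∑ j, star (V j k) * ((a j : ℂ) * G j i) := by
      simp only [mulVec, dotProduct, Finset.mul_sum, ← Finset.sum_sub_distrib, hy, hg,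
        conjTranspose_apply]
      refine Finset.sum_congr rfl fun j _ => ?_
      push_cast
      ring
    have h3 : (Vᴴ * G) k i = (Vᴴ *ᵥ g) k := rfl
    rw [h2, ← h1, h3]
    push_cast
    ring
  have h1 : ∑ k, (star ((Vᴴ *ᵥ g) k) * (Vᴴ *ᵥ y) k).re =
      ∑ j, (a i - a j) * Complex.normSq (G j i) := by
    rw [← Complex.re_sum]
    have := star_mulVec_dotProduct_mulVec_of_unitary hV g y
    simp only [dotProduct, Pi.star_apply] at this
    rw [this, Complex.re_sum]
    refine Finset.sum_congr rfl fun j _ => ?_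
    simp [hg, hy, Complex.normSq_apply]
    ring
  have h2 : ∑ k, Complex.normSq ((Vᴴ *ᵥ y) k) =
      ∑ j, (a i - a j) ^ 2 * Complex.normSq (G j i) := by
    have := congrArg Complex.re (star_mulVec_dotProduct_mulVec_of_unitary hV y y)
    simp only [dotProduct, Pi.star_apply, Complex.re_sum, Complex.star_def,
      ← Complex.normSq_eq_conj_mul_self, Complex.ofReal_re] at this
    rw [this]
    refine Finset.sum_congr rfl fun j _ => ?_
    simp only [hy, Complex.normSq_mul, Complex.normSq_ofReal]
    ring
  have h3 := Finset.sum_le_sum fun k (_ : k ∈ Finset.univ) =>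
    re_mul_ge_of_mul_eq_add (ha i) (le_add_of_nonneg_right (hb k)) (hk k)
  rw [Finset.sum_sub_distrib, Finset.sum_add_distrib, h1, ← Finset.sum_div, h2, ← Complex.re_sum,
    ← hGi] at h3
  refine le_trans (le_of_eq ?_) h3
  rw [add_sub_assoc, Finset.sum_div, ← Finset.sum_sub_distrib]
  congr 1
  refine Finset.sum_congr rfl fun j _ => ?_
  ring

lemma sum_cube_div_add_normSq_le {a b : ι → ℝ} (ha : ∀ i, 0 < a i) (hb : ∀ k, 0 ≤ b k)
    {V G : Matrix ι ι ℂ} (hV : V * Vᴴ = 1) (hGh : G.IsHermitian)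
    (hG : (diagonal (fun i => (a i : ℂ)) + V * diagonal (fun k => (b k : ℂ)) * Vᴴ) * G = 1) :
    ∑ i, ∑ k, a i ^ 3 * (Complex.normSq (V i k) / (a i + b k)) ≤ ∑ i, a i ^ 3 * (G i i).re := by
  have h1 : ∑ i, a i ^ 3 * (∑ k, Complex.normSq (V i k) / (a i + b k) +
      ∑ j, ((a i - a j) - (a i - a j) ^ 2 / a i) * Complex.normSq (G j i)) ≤
      ∑ i, a i ^ 3 * (G i i).re :=
    Finset.sum_le_sum fun i _ => mul_le_mul_of_nonneg_left
      (sum_div_add_normSq_le_re_diag ha hb hV hG i) (pow_nonneg (ha i).le 3)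
  have hsymm : ∀ i j, Complex.normSq (G j i) = Complex.normSq (G i j) := fun i j => by
    rw [← hGh.apply i j, Complex.star_def, Complex.normSq_conj]
  set F : ι → ι → ℝ := fun i j => a i ^ 2 * a j * (a i - a j) * Complex.normSq (G j i) with hF
  have h2 : 0 ≤ ∑ i, ∑ j, F i j := by
    have h3 : 0 ≤ ∑ i, ∑ j, (F i j + F j i) := by
      refine Finset.sum_nonneg fun i _ => Finset.sum_nonneg fun j _ => ?_
      have : F i j + F j i = a i * a j * (a i - a j) ^ 2 * Complex.normSq (G j i) := by
        simp only [hF, hsymm j i]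
        ring
      rw [this]
      have := (ha i).le
      have := (ha j).le
      have := Complex.normSq_nonneg (G j i)
      positivity
    simp only [Finset.sum_add_distrib] at h3
    rw [Finset.sum_comm (f := fun i j => F j i)] at h3
    linarith
  have h4 : ∑ i, a i ^ 3 * (∑ k, Complex.normSq (V i k) / (a i + b k) +
      ∑ j, ((a i - a j) - (a i - a j) ^ 2 / a i) * Complex.normSq (G j i)) =
      ∑ i, ∑ k, a i ^ 3 * (Complex.normSq (V i k) / (a i + b k)) + ∑ i, ∑ j, F i j := by
    rw [← Finset.sum_add_distrib]
    refine Finset.sum_congr rfl fun i _ => ?_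
    rw [mul_add, Finset.mul_sum, Finset.mul_sum]
    congr 1
    refine Finset.sum_congr rfl fun j _ => ?_
    have := (ha i).ne'
    simp only [hF]
    field_simp
    ring
  linarith

end ResolventComparison

open MeasureTheory in
/-- A comparison of Stieltjes transforms of two discrete measures of equal mass passes to their
moments of order `t ∈ [0, 1]`. -/
lemma sum_mul_rpow_le_of_sum_div_add_le.{u} {α β : Type u} [Fintype α] [Fintype β]
    {w x : α → ℝ} {v y : β → ℝ} (hx : ∀ i, 0 < x i) (hy : ∀ j, 0 < y j)
    (hmass : ∑ i, w i = ∑ j, v j)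
    (h : ∀ s : ℝ, 0 < s → ∑ j, v j * (s + y j)⁻¹ ≤ ∑ i, w i * (s + x i)⁻¹)
    {t : ℝ} (ht : t ∈ Set.Icc (0 : ℝ) 1) :
    ∑ i, w i * x i ^ t ≤ ∑ j, v j * y j ^ t := by
  have hclosed : IsClosed {t : ℝ | ∑ i, w i * x i ^ t ≤ ∑ j, v j * y j ^ t} := by
    refine isClosed_le ?_ ?_
    · exact continuous_finsetSum _ fun i _ =>
        continuous_const.mul (Real.continuous_const_rpow (hx i).ne')
    · exact continuous_finsetSum _ fun j _ =>
        continuous_const.mul (Real.continuous_const_rpow (hy j).ne')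
  rw [← closure_Ioo (zero_ne_one' ℝ)] at ht
  refine hclosed.closure_subset_iff.mpr (fun p hp => ?_) ht
  have hpos : 0 < ∫ s in Set.Ioi 0, Real.rpowIntegrand₀₁ p s 1 :=
    Real.integral_rpowIntegrand₀₁_one_pos hp
  have hint {z : ℝ} (hz : 0 < z) : IntegrableOn (Real.rpowIntegrand₀₁ p · z) (Set.Ioi 0) :=
    Real.integrableOn_rpowIntegrand₀₁_Ioi hp hz.le
  refine le_of_mul_le_mul_right ?_ hpos
  have hsum {γ : Type u} [Fintype γ] (u z : γ → ℝ) (hz : ∀ i, 0 < z i) :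
      (∑ i, u i * z i ^ p) * (∫ s in Set.Ioi 0, Real.rpowIntegrand₀₁ p s 1) =
        ∫ s in Set.Ioi 0, ∑ i, u i * Real.rpowIntegrand₀₁ p s (z i) := by
    rw [integral_finsetSum _ fun i _ => (hint (hz i)).const_mul (u i), Finset.sum_mul]
    refine Finset.sum_congr rfl fun i _ => ?_
    rw [integral_const_mul, Real.integral_rpowIntegrand₀₁_eq_rpow_mul_const hp (hz i).le, mul_assoc]
  rw [hsum w x hx, hsum v y hy]
  refine setIntegral_mono_on (integrable_finsetSum _ fun i _ => (hint (hx i)).const_mul _)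
    (integrable_finsetSum _ fun j _ => (hint (hy j)).const_mul _) measurableSet_Ioi
    fun s hs => ?_
  have hexp {γ : Type u} [Fintype γ] (u z : γ → ℝ) :
      ∑ i, u i * Real.rpowIntegrand₀₁ p s (z i) =
        s ^ p * (s⁻¹ * ∑ i, u i - ∑ i, u i * (s + z i)⁻¹) := by
    rw [Finset.mul_sum, ← Finset.sum_sub_distrib, Finset.mul_sum]
    refine Finset.sum_congr rfl fun i _ => ?_
    simp only [Real.rpowIntegrand₀₁]
    ring
  rw [hexp, hexp, hmass]
  exact mul_le_mul_of_nonneg_left (sub_le_sub_left (h s hs) _) (Real.rpow_nonneg (le_of_lt hs) p)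

section DiagonalForm

variable {ι : Type*} [Fintype ι] [DecidableEq ι]

lemma mul_diagonal_mul_conjTranspose_apply_self (V : Matrix ι ι ℂ) (b : ι → ℝ) (i : ι) :
    (V * diagonal (fun k => (b k : ℂ)) * Vᴴ) i i =
      ((∑ k, b k * Complex.normSq (V i k) : ℝ) : ℂ) := by
  rw [Matrix.mul_apply, Complex.ofReal_sum]
  refine Finset.sum_congr rfl fun k _ => ?_
  rw [mul_diagonal, conjTranspose_apply, Complex.ofReal_mul, Complex.normSq_eq_conj_mul_self,
    Complex.star_def]
  ring

lemma sum_normSq_row {V : Matrix ι ι ℂ} (hV : V * Vᴴ = 1) (i : ι) :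
    ∑ k, Complex.normSq (V i k) = 1 := by
  have h := mul_diagonal_mul_conjTranspose_apply_self V (fun _ => 1) i
  simp only [Complex.ofReal_one, diagonal_one, Matrix.mul_one, hV, one_apply_eq, one_mul] at h
  exact_mod_cast h.symm

lemma sum_sq_mul_rpow_normSq_le {a c b x : ι → ℝ} (hc : ∀ i, 0 < c i) (hca : ∀ i, c i * c i = a i)
    (hb : ∀ i, 0 < b i) (hx : ∀ i, 0 < x i) {Q V : Matrix ι ι ℂ} (hQ : Q * Qᴴ = 1)
    (hV : V * Vᴴ = 1)
    (h : diagonal (fun i => (c i : ℂ)) * (Q * diagonal (fun i => (x i : ℂ)) * Qᴴ) *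
      diagonal (fun i => (c i : ℂ)) = V * diagonal (fun i => (b i : ℂ)) * Vᴴ)
    {t : ℝ} (ht : t ∈ Set.Icc (0 : ℝ) 1) :
    ∑ i, ∑ j, a i ^ (2 : ℝ) * x j ^ t * Complex.normSq (Q i j) ≤
      ∑ i, ∑ k, a i ^ (2 - t) * b k ^ t * Complex.normSq (V i k) := by
  have ha : ∀ i, 0 < a i := fun i => hca i ▸ mul_pos (hc i) (hc i)
  have hQ' : Qᴴ * Q = 1 := mul_eq_one_comm.mp hQ
  have hres : ∀ s : ℝ, 0 < s →
      ∑ q : ι × ι, a q.1 ^ 2 * Complex.normSq (V q.1 q.2) * (s + b q.2 / a q.1)⁻¹ ≤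
        ∑ q : ι × ι, a q.1 ^ 2 * Complex.normSq (Q q.1 q.2) * (s + x q.2)⁻¹ := by
    intro s hs
    set R : Matrix ι ι ℂ := Q * diagonal (fun j => (((s + x j)⁻¹ : ℝ) : ℂ)) * Qᴴ with hR
    set C' : Matrix ι ι ℂ := diagonal (fun i => (((c i)⁻¹ : ℝ) : ℂ)) with hC'
    have hRh : R.IsHermitian := by
      refine isHermitian_mul_mul_conjTranspose _ (isHermitian_diagonal_iff.mpr fun j => ?_)
      rw [isSelfAdjoint_iff, Complex.star_def, Complex.conj_ofReal]
    have hC'h : C'ᴴ = C' := by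
      rw [hC', diagonal_conjTranspose]
      congr 1
      ext i
      simp
    have hGh : (C' * R * C').IsHermitian := by
      have := isHermitian_mul_mul_conjTranspose C' hRh
      rwa [hC'h] at this
    have hsR : diagonal (fun i => ((s * a i : ℝ) : ℂ)) + V * diagonal (fun k => (b k : ℂ)) * Vᴴ =
        diagonal (fun i => (c i : ℂ)) * (Q * diagonal (fun i => ((s + x i : ℝ) : ℂ)) * Qᴴ) *
          diagonal (fun i => (c i : ℂ)) := by
      have e1 : (diagonal fun i => ((s + x i : ℝ) : ℂ)) =
          (s : ℂ) • (1 : Matrix ι ι ℂ) + diagonal fun i => (x i : ℂ) := by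
        rw [← diagonal_one, ← diagonal_smul, diagonal_add]
        congr 1
        ext i
        simp
      rw [← h, e1, Matrix.mul_add, Matrix.add_mul, Matrix.mul_add, Matrix.add_mul]
      congr 1
      simp only [Matrix.mul_smul, Matrix.smul_mul, Matrix.mul_one, hQ, diagonal_mul_diagonal]
      rw [← diagonal_smul]
      congr 1
      ext i
      simp [← hca]
    have hcc : diagonal (fun i => (c i : ℂ)) * C' = 1 := by
      rw [hC', diagonal_mul_diagonal, ← diagonal_one]
      congr 1
      ext i
      have := (hc i).ne'
      push_cast
      exact mul_inv_cancel₀ (by exact_mod_cast this)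
    have hss : diagonal (fun i => ((s + x i : ℝ) : ℂ)) *
        diagonal (fun j => (((s + x j)⁻¹ : ℝ) : ℂ)) = 1 := by
      rw [diagonal_mul_diagonal, ← diagonal_one]
      congr 1
      ext i
      have := (add_pos hs (hx i)).ne'
      rw [Complex.ofReal_inv]
      exact mul_inv_cancel₀ (by exact_mod_cast this)
    have hQR : (Q * diagonal (fun i => ((s + x i : ℝ) : ℂ)) * Qᴴ) * R = 1 := by
      rw [hR]
      calc _ = Q * diagonal (fun i => ((s + x i : ℝ) : ℂ)) * (Qᴴ * Q) *
              diagonal (fun j => (((s + x j)⁻¹ : ℝ) : ℂ)) * Qᴴ := by simp only [Matrix.mul_assoc]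
        _ = Q * (diagonal (fun i => ((s + x i : ℝ) : ℂ)) *
              diagonal (fun j => (((s + x j)⁻¹ : ℝ) : ℂ))) * Qᴴ := by
            rw [hQ', Matrix.mul_one, Matrix.mul_assoc Q]
        _ = 1 := by rw [hss, Matrix.mul_one, hQ]
    have hG : (diagonal (fun i => ((s * a i : ℝ) : ℂ)) +
        V * diagonal (fun k => (b k : ℂ)) * Vᴴ) * (C' * R * C') = 1 := by
      rw [hsR]
      calc _ = diagonal (fun i => (c i : ℂ)) * ((Q * diagonal (fun i => ((s + x i : ℝ) : ℂ)) * Qᴴ) *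
              (diagonal (fun i => (c i : ℂ)) * C') * R) * C' := by simp only [Matrix.mul_assoc]
        _ = 1 := by rw [hcc, Matrix.mul_one, hQR, Matrix.mul_one, hcc]
    have key := sum_cube_div_add_normSq_le (fun i => mul_pos hs (ha i)) (fun k => (hb k).le) hV
      hGh hG
    have hdiag : ∀ i, ((C' * R * C') i i).re =
        (a i)⁻¹ * ∑ j, (s + x j)⁻¹ * Complex.normSq (Q i j) := by
      intro i
      rw [hC', mul_diagonal, diagonal_mul, hR, mul_diagonal_mul_conjTranspose_apply_self,
        ← Complex.ofReal_mul, ← Complex.ofReal_mul, Complex.ofReal_re, ← hca, mul_inv]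
      ring
    rw [Fintype.sum_prod_type, Fintype.sum_prod_type]
    refine le_of_mul_le_mul_left ?_ (pow_pos hs 3)
    refine (le_of_eq ?_).trans (key.trans (le_of_eq ?_))
    · simp only [Finset.mul_sum]
      refine Finset.sum_congr rfl fun i _ => Finset.sum_congr rfl fun k _ => ?_
      have := ha i
      have := hb k
      field_simp
    · simp only [hdiag, Finset.mul_sum]
      refine Finset.sum_congr rfl fun i _ => Finset.sum_congr rfl fun k _ => ?_
      have := (ha i).ne'
      field_simp
  have hmass : ∑ q : ι × ι, a q.1 ^ 2 * Complex.normSq (Q q.1 q.2) =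
      ∑ q : ι × ι, a q.1 ^ 2 * Complex.normSq (V q.1 q.2) := by
    simp only [Fintype.sum_prod_type, ← Finset.mul_sum, sum_normSq_row hQ, sum_normSq_row hV]
  have key := sum_mul_rpow_le_of_sum_div_add_le (fun q => hx q.2)
    (fun q => div_pos (hb q.2) (ha q.1)) hmass hres ht
  rw [Fintype.sum_prod_type, Fintype.sum_prod_type] at key
  convert key using 1
  · refine Finset.sum_congr rfl fun i _ => Finset.sum_congr rfl fun k _ => ?_
    rw [Real.rpow_two]
    ring
  · refine Finset.sum_congr rfl fun i _ => Finset.sum_congr rfl fun k _ => ?_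
    rw [Real.rpow_sub (ha i), Real.rpow_two, Real.div_rpow (hb k).le (ha i).le]
    ring

end DiagonalForm

section RealPowers

variable {n : ℕ} {A B : Matrix (Fin n) (Fin n) ℂ}

lemma mpow_eq_mul_diagonal_mul (hA : A.IsHermitian) (r : ℝ) :
    mpow A r = (hA.eigenvectorUnitary : Matrix (Fin n) (Fin n) ℂ) *
      diagonal (fun i => ((hA.eigenvalues i ^ r : ℝ) : ℂ)) *
      (hA.eigenvectorUnitary : Matrix (Fin n) (Fin n) ℂ)ᴴ := by
  rw [mpow, dif_pos hA]
  rfl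

lemma eigenvectorUnitary_mul_conjTranspose (hA : A.IsHermitian) :
    (hA.eigenvectorUnitary : Matrix (Fin n) (Fin n) ℂ) *
      (hA.eigenvectorUnitary : Matrix (Fin n) (Fin n) ℂ)ᴴ = 1 :=
  Unitary.coe_mul_star_self hA.eigenvectorUnitary

lemma conjTranspose_mul_eigenvectorUnitary (hA : A.IsHermitian) :
    (hA.eigenvectorUnitary : Matrix (Fin n) (Fin n) ℂ)ᴴ *
      (hA.eigenvectorUnitary : Matrix (Fin n) (Fin n) ℂ) = 1 :=
  Unitary.coe_star_mul_self hA.eigenvectorUnitary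

lemma mpow_one (hA : A.IsHermitian) : mpow A 1 = A := by
  rw [mpow_eq_mul_diagonal_mul hA]
  conv_rhs => rw [hA.spectral_theorem]
  simp only [Real.rpow_one, Unitary.conjStarAlgAut_apply]
  rfl

lemma mpow_zero (hA : A.IsHermitian) : mpow A 0 = 1 := by
  simp [mpow_eq_mul_diagonal_mul hA, eigenvectorUnitary_mul_conjTranspose hA]

lemma mpow_mul_mpow (hA : A.PosDef) (r s : ℝ) : mpow A r * mpow A s = mpow A (r + s) := by
  have h := hA.isHermitian
  rw [mpow_eq_mul_diagonal_mul h, mpow_eq_mul_diagonal_mul h, mpow_eq_mul_diagonal_mul h]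
  set U := (h.eigenvectorUnitary : Matrix (Fin n) (Fin n) ℂ)
  calc _ = U * diagonal (fun i => ((h.eigenvalues i ^ r : ℝ) : ℂ)) * (Uᴴ * U) *
        diagonal (fun i => ((h.eigenvalues i ^ s : ℝ) : ℂ)) * Uᴴ := by simp only [Matrix.mul_assoc]
    _ = _ := by
      rw [conjTranspose_mul_eigenvectorUnitary h, Matrix.mul_one, Matrix.mul_assoc U,
        diagonal_mul_diagonal]
      simp only [← Complex.ofReal_mul, ← Real.rpow_add (hA.eigenvalues_pos _)]

lemma isHermitian_mpow (A : Matrix (Fin n) (Fin n) ℂ) (r : ℝ) : (mpow A r).IsHermitian := by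
  by_cases hA : A.IsHermitian
  · rw [mpow_eq_mul_diagonal_mul hA]
    refine isHermitian_mul_mul_conjTranspose _ (isHermitian_diagonal_iff.mpr fun j => ?_)
    rw [isSelfAdjoint_iff, Complex.star_def, Complex.conj_ofReal]
  · rw [mpow, dif_neg hA]
    exact isHermitian_zero

lemma mpow_mul_mpow_neg (hA : A.PosDef) (r : ℝ) : mpow A r * mpow A (-r) = 1 := by
  rw [mpow_mul_mpow hA, add_neg_cancel, mpow_zero hA.isHermitian]

lemma mpow_neg_mul_mpow (hA : A.PosDef) (r : ℝ) : mpow A (-r) * mpow A r = 1 := by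
  rw [mpow_mul_mpow hA, neg_add_cancel, mpow_zero hA.isHermitian]

lemma mpow_half_mul_mpow_half (hA : A.PosDef) : mpow A (1 / 2) * mpow A (1 / 2) = A := by
  rw [mpow_mul_mpow hA, add_halves, mpow_one hA.isHermitian]

lemma posDef_mpow_mul_mul_mpow (hA : A.PosDef) (hB : B.PosDef) (r : ℝ) :
    (mpow A r * B * mpow A r).PosDef := by
  have hinj : Function.Injective (mpow A r).vecMul := by
    refine Function.LeftInverse.injective (g := (mpow A (-r)).vecMul) fun v => ?_
    simp [vecMul_vecMul, mpow_mul_mpow_neg hA]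
  have := hB.mul_mul_conjTranspose_same (B := mpow A r) hinj
  rwa [(isHermitian_mpow A r).eq] at this

lemma trace_mpow_mul_mpow (hA : A.IsHermitian) (hB : B.IsHermitian) (r s : ℝ) :
    (mpow A r * mpow B s).trace =
      ((∑ i, ∑ k, hA.eigenvalues i ^ r * hB.eigenvalues k ^ s *
        Complex.normSq (((hA.eigenvectorUnitary : Matrix (Fin n) (Fin n) ℂ)ᴴ *
          (hB.eigenvectorUnitary : Matrix (Fin n) (Fin n) ℂ)) i k) : ℝ) : ℂ) := by
  rw [mpow_eq_mul_diagonal_mul hA, mpow_eq_mul_diagonal_mul hB]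
  set U := (hA.eigenvectorUnitary : Matrix (Fin n) (Fin n) ℂ)
  set V := (hB.eigenvectorUnitary : Matrix (Fin n) (Fin n) ℂ)
  set D := diagonal (fun i => ((hA.eigenvalues i ^ r : ℝ) : ℂ)) with hD
  set E := diagonal (fun i => ((hB.eigenvalues i ^ s : ℝ) : ℂ)) with hE
  have h1 : (U * D * Uᴴ * (V * E * Vᴴ)).trace = (D * ((Uᴴ * V) * E * (Uᴴ * V)ᴴ)).trace := by
    rw [conjTranspose_mul, conjTranspose_conjTranspose, Matrix.mul_assoc U, Matrix.mul_assoc U,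
      trace_mul_comm]
    simp only [Matrix.mul_assoc]
  rw [h1, trace, Complex.ofReal_sum]
  refine Finset.sum_congr rfl fun i _ => ?_
  rw [diag_apply, hD, diagonal_mul, hE, mul_diagonal_mul_conjTranspose_apply_self,
    ← Complex.ofReal_mul, Finset.mul_sum]
  simp only [mul_assoc]

lemma trace_mul_geomMean_le (hA : A.PosDef) (hB : B.PosDef) {t : ℝ}
    (ht : t ∈ Set.Icc (0 : ℝ) 1) :
    (A * geomMean A B t).trace ≤ (mpow A (2 - t) * mpow B t).trace := by
  have hX := posDef_mpow_mul_mul_mpow hA hB (-(1 / 2))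
  have hXdef : mpow A (1 / 2) * (mpow A (-(1 / 2)) * B * mpow A (-(1 / 2))) * mpow A (1 / 2) =
      B := by
    calc _ = (mpow A (1 / 2) * mpow A (-(1 / 2))) * B * (mpow A (-(1 / 2)) * mpow A (1 / 2)) := by
          simp only [Matrix.mul_assoc]
      _ = B := by rw [mpow_mul_mpow_neg hA, mpow_neg_mul_mpow hA, Matrix.one_mul, Matrix.mul_one]
  rw [geomMean]
  set X := mpow A (-(1 / 2)) * B * mpow A (-(1 / 2))
  have h1 : (A * (mpow A (1 / 2) * mpow X t * mpow A (1 / 2))).trace =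
      (mpow A 2 * mpow X t).trace := by
    have h2 : mpow A (1 / 2) * A * mpow A (1 / 2) = mpow A 2 := by
      nth_rewrite 2 [← mpow_one hA.isHermitian]
      rw [mpow_mul_mpow hA, mpow_mul_mpow hA]
      norm_num
    rw [← h2, ← Matrix.mul_assoc, trace_mul_comm]
    simp only [Matrix.mul_assoc]
  rw [h1, trace_mpow_mul_mpow hA.isHermitian hX.isHermitian,
    trace_mpow_mul_mpow hA.isHermitian hB.isHermitian, Complex.real_le_real]
  have hUU := conjTranspose_mul_eigenvectorUnitary hA.isHermitian
  have hunit : ∀ {M : Matrix (Fin n) (Fin n) ℂ} (hM : M.IsHermitian),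
      ((hA.isHermitian.eigenvectorUnitary : Matrix (Fin n) (Fin n) ℂ)ᴴ *
        (hM.eigenvectorUnitary : Matrix (Fin n) (Fin n) ℂ)) *
      ((hA.isHermitian.eigenvectorUnitary : Matrix (Fin n) (Fin n) ℂ)ᴴ *
        (hM.eigenvectorUnitary : Matrix (Fin n) (Fin n) ℂ))ᴴ = 1 := by
    intro M hM
    rw [conjTranspose_mul, conjTranspose_conjTranspose, Matrix.mul_assoc,
      ← Matrix.mul_assoc (hM.eigenvectorUnitary : Matrix (Fin n) (Fin n) ℂ),
      eigenvectorUnitary_mul_conjTranspose hM, Matrix.one_mul, hUU]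
  refine sum_sq_mul_rpow_normSq_le (c := fun i => hA.isHermitian.eigenvalues i ^ (1 / 2 : ℝ))
    (fun i => Real.rpow_pos_of_pos (hA.eigenvalues_pos i) _) (fun i => ?_) hB.eigenvalues_pos
    hX.eigenvalues_pos (hunit hX.isHermitian) (hunit hB.isHermitian) ?_ ht
  · rw [← Real.rpow_add (hA.eigenvalues_pos i), add_halves, Real.rpow_one]
  · have hX1 := mpow_one hX.isHermitian
    have hB1 := mpow_one hB.isHermitian
    rw [mpow_eq_mul_diagonal_mul hX.isHermitian] at hX1
    rw [mpow_eq_mul_diagonal_mul hB.isHermitian] at hB1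
    simp only [Real.rpow_one] at hX1 hB1
    rw [mpow_eq_mul_diagonal_mul hA.isHermitian] at hXdef
    set U := (hA.isHermitian.eigenvectorUnitary : Matrix (Fin n) (Fin n) ℂ)
    set W := (hX.isHermitian.eigenvectorUnitary : Matrix (Fin n) (Fin n) ℂ)
    set V := (hB.isHermitian.eigenvectorUnitary : Matrix (Fin n) (Fin n) ℂ)
    set D := diagonal (fun i => ((hA.isHermitian.eigenvalues i ^ (1 / 2 : ℝ) : ℝ) : ℂ))
    set E := diagonal (fun i => (hX.isHermitian.eigenvalues i : ℂ))
    set F := diagonal (fun i => (hB.isHermitian.eigenvalues i : ℂ))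
    calc D * (Uᴴ * W * E * (Uᴴ * W)ᴴ) * D = D * Uᴴ * (W * E * Wᴴ) * U * D := by
          rw [conjTranspose_mul, conjTranspose_conjTranspose]
          simp only [Matrix.mul_assoc]
      _ = (Uᴴ * U) * D * Uᴴ * X * U * D * (Uᴴ * U) := by
          rw [hX1, hUU, Matrix.one_mul, Matrix.mul_one]
      _ = Uᴴ * (U * D * Uᴴ * X * (U * D * Uᴴ)) * U := by simp only [Matrix.mul_assoc]
      _ = Uᴴ * (V * F * Vᴴ) * U := by rw [hXdef, hB1]
      _ = Uᴴ * V * F * (Uᴴ * V)ᴴ := by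
          rw [conjTranspose_mul, conjTranspose_conjTranspose]
          simp only [Matrix.mul_assoc]

/-- If `C` intertwines `M` with the inverse of `N`, then it intertwines their real powers. -/
lemma mpow_mul_eq_mul_mpow_neg {M N C : Matrix (Fin n) (Fin n) ℂ} (hM : M.PosDef)
    (hN : N.PosDef) (h : N * C * M = C) (t : ℝ) : mpow N t * C = C * mpow M (-t) := by
  have hM1 := mpow_one hM.isHermitian
  have hN1 := mpow_one hN.isHermitian
  rw [mpow_eq_mul_diagonal_mul hM.isHermitian] at hM1
  rw [mpow_eq_mul_diagonal_mul hN.isHermitian] at hN1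
  rw [mpow_eq_mul_diagonal_mul hM.isHermitian, mpow_eq_mul_diagonal_mul hN.isHermitian]
  have hUU := conjTranspose_mul_eigenvectorUnitary hM.isHermitian
  have hUU' := eigenvectorUnitary_mul_conjTranspose hM.isHermitian
  have hVV := conjTranspose_mul_eigenvectorUnitary hN.isHermitian
  have hVV' := eigenvectorUnitary_mul_conjTranspose hN.isHermitian
  simp only [Real.rpow_one] at hM1 hN1
  set U := (hM.isHermitian.eigenvectorUnitary : Matrix (Fin n) (Fin n) ℂ)
  set V := (hN.isHermitian.eigenvectorUnitary : Matrix (Fin n) (Fin n) ℂ)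
  set K := Vᴴ * C * U with hK
  have hCK : C = V * K * Uᴴ := by
    calc C = (V * Vᴴ) * C * (U * Uᴴ) := by rw [hVV', hUU', Matrix.one_mul, Matrix.mul_one]
      _ = _ := by simp only [hK, Matrix.mul_assoc]
  have hKe : diagonal (fun i => (hN.isHermitian.eigenvalues i : ℂ)) * K *
      diagonal (fun i => (hM.isHermitian.eigenvalues i : ℂ)) = K := by
    set D := diagonal (fun i => (hM.isHermitian.eigenvalues i : ℂ))
    set E := diagonal (fun i => (hN.isHermitian.eigenvalues i : ℂ))
    calc E * K * D = (Vᴴ * V) * E * Vᴴ * C * U * D * (Uᴴ * U) := by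
          rw [hVV, hUU, Matrix.one_mul, Matrix.mul_one, hK]
          simp only [Matrix.mul_assoc]
      _ = Vᴴ * ((V * E * Vᴴ) * C * (U * D * Uᴴ)) * U := by simp only [Matrix.mul_assoc]
      _ = K := by rw [hM1, hN1, h]
  have hKt : diagonal (fun i => ((hN.isHermitian.eigenvalues i ^ t : ℝ) : ℂ)) * K =
      K * diagonal (fun i => ((hM.isHermitian.eigenvalues i ^ (-t) : ℝ) : ℂ)) := by
    ext i j
    have hij := congrFun (congrFun hKe i) j
    rw [mul_diagonal, diagonal_mul] at hij
    rw [mul_diagonal, diagonal_mul]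
    by_cases hk : K i j = 0
    · rw [hk, mul_zero, zero_mul]
    · have h1 : ((hN.isHermitian.eigenvalues i * hM.isHermitian.eigenvalues j : ℝ) : ℂ) *
          K i j = 1 * K i j := by
        rw [one_mul]
        nth_rewrite 2 [← hij]
        push_cast
        ring
      have h2 : hN.isHermitian.eigenvalues i * hM.isHermitian.eigenvalues j = 1 := by
        exact_mod_cast mul_right_cancel₀ hk h1
      rw [eq_inv_of_mul_eq_one_left h2, Real.inv_rpow (hM.eigenvalues_pos j).le,
        Real.rpow_neg (hM.eigenvalues_pos j).le, mul_comm]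
  set D := diagonal (fun i => ((hM.isHermitian.eigenvalues i ^ (-t) : ℝ) : ℂ))
  set E := diagonal (fun i => ((hN.isHermitian.eigenvalues i ^ t : ℝ) : ℂ))
  calc V * E * Vᴴ * C = V * E * (Vᴴ * V) * K * Uᴴ := by
        nth_rewrite 1 [hCK]
        simp only [Matrix.mul_assoc]
    _ = V * (E * K) * Uᴴ := by rw [hVV, Matrix.mul_one, Matrix.mul_assoc V]
    _ = V * K * (Uᴴ * U) * D * Uᴴ := by
        rw [hKt, hUU, Matrix.mul_one]
        simp only [Matrix.mul_assoc]
    _ = C * (U * D * Uᴴ) := by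
        nth_rewrite 1 [hCK]
        simp only [Matrix.mul_assoc]

lemma geomMean_one_sub (hA : A.PosDef) (hB : B.PosDef) (t : ℝ) :
    geomMean A B (1 - t) = geomMean B A t := by
  have hX := posDef_mpow_mul_mul_mpow hA hB (-(1 / 2))
  have hY := posDef_mpow_mul_mul_mpow hB hA (-(1 / 2))
  have hA1 := mpow_mul_mpow_neg hA (1 / 2)
  have hA2 := mpow_neg_mul_mpow hA (1 / 2)
  have hA3 := mpow_half_mul_mpow_half hA
  have hB2 := mpow_neg_mul_mpow hB (1 / 2)
  have hB3 := mpow_half_mul_mpow_half hB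
  have hXmul := mpow_mul_mpow hX 1 (-t)
  rw [mpow_one hX.isHermitian, ← sub_eq_add_neg] at hXmul
  rw [geomMean, geomMean, ← hXmul]
  set S := mpow A (1 / 2)
  set S' := mpow A (-(1 / 2))
  set R := mpow B (1 / 2)
  set R' := mpow B (-(1 / 2))
  have hC : (R' * A * R') * (R * S') * (S' * B * S') = R * S' := by
    calc _ = R' * A * (R' * R) * S' * S' * B * S' := by simp only [Matrix.mul_assoc]
      _ = R' * (S * (S * S') * S') * B * S' := by
          rw [hB2, Matrix.mul_one]
          nth_rewrite 1 [← hA3]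
          simp only [Matrix.mul_assoc]
      _ = (R' * R) * R * S' := by
          rw [hA1, Matrix.mul_one, hA1, Matrix.mul_one]
          nth_rewrite 1 [← hB3]
          simp only [Matrix.mul_assoc]
      _ = R * S' := by rw [hB2, Matrix.one_mul]
  have key := mpow_mul_eq_mul_mpow_neg hX hY hC t
  set X := S' * B * S' with hXdef
  set Y := R' * A * R'
  calc S * (X * mpow X (-t)) * S = (S * S') * B * S' * mpow X (-t) * S := by
        nth_rewrite 1 [hXdef]
        simp only [Matrix.mul_assoc]
    _ = R * (R * S' * mpow X (-t)) * S := by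
        rw [hA1, Matrix.one_mul]
        nth_rewrite 1 [← hB3]
        simp only [Matrix.mul_assoc]
    _ = R * mpow Y t * R * (S' * S) := by
        rw [← key]
        simp only [Matrix.mul_assoc]
    _ = R * mpow Y t * R := by rw [hA2, Matrix.mul_one]

end RealPowers

/-- `Tr((A+B)(A♯ₜB + A♯₁₋ₜB)) ≤
Tr(A^{t+1}B^{1-t} + A^{2-t}Bᵗ + AᵗB^{2-t} + A^{1-t}B^{1+t})`. -/
theorem stmt_11 {n : ℕ} (A B : Matrix (Fin n) (Fin n) ℂ)
    (hA : A.PosDef) (hB : B.PosDef) (t : ℝ) (ht : t ∈ Set.Icc (0:ℝ) 1) :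
    ((A + B) * (geomMean A B t + geomMean A B (1 - t))).trace ≤
      (mpow A (t + 1) * mpow B (1 - t) + mpow A (2 - t) * mpow B t +
        mpow A t * mpow B (2 - t) + mpow A (1 - t) * mpow B (1 + t)).trace := by
  have ht' : 1 - t ∈ Set.Icc (0 : ℝ) 1 := ⟨by linarith [ht.2], by linarith [ht.1]⟩
  have hAt := trace_mul_geomMean_le hA hB ht
  have hAt' := trace_mul_geomMean_le hA hB ht'
  have hBt := trace_mul_geomMean_le hB hA ht
  have hBt' := trace_mul_geomMean_le hB hA ht'
  rw [← geomMean_one_sub hA hB t, trace_mul_comm (mpow B _)] at hBt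
  rw [geomMean_one_sub hB hA t, trace_mul_comm (mpow B _)] at hBt'
  rw [show 2 - (1 - t) = t + 1 by ring] at hAt'
  rw [show 2 - (1 - t) = 1 + t by ring] at hBt'
  simp only [Matrix.add_mul, Matrix.mul_add, trace_add]
  calc _ = (A * geomMean A B (1 - t)).trace + (A * geomMean A B t).trace +
        (B * geomMean A B (1 - t)).trace + (B * geomMean A B t).trace := by ring
    _ ≤ _ := add_le_add (add_le_add (add_le_add hAt' hAt) hBt) hBt'
end

section
/- Let A and B be n×n positive definite complex matrices and s ∈ [0,1]. Then ‖((1−s)/2)(A + B) + s(A♯B)‖₁ ≤ ‖((1−s)/2)(A + B) + s A^{1/2} B^{1/2}‖₁, where ‖X‖₁ = Tr((X*X)^{1/2}) is the trace norm, X* denotes the conjugate transpose, and A♯B = A♯_{1/2}B is the geometric mean. -/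
open Matrix ComplexOrder

/-- The trace norm ‖X‖₁ = Tr((X*X)^{1/2}). -/
noncomputable def traceNorm {n : ℕ} (X : Matrix (Fin n) (Fin n) ℂ) : ℝ :=
  ((mpow (Xᴴ * X) (1/2)).trace).re

/-- The Hilbert–Schmidt (Frobenius) norm ‖X‖₂ = (Tr(X*X))^{1/2}. -/
noncomputable def hsNorm {n : ℕ} (X : Matrix (Fin n) (Fin n) ℂ) : ℝ :=
  Real.sqrt ((Xᴴ * X).trace.re)

namespace Matrix

variable {n : ℕ} {A B C D P V : Matrix (Fin n) (Fin n) ℂ}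

lemma IsHermitian.eq_conj_diagonal (hA : A.IsHermitian) :
    A = (hA.eigenvectorUnitary : Matrix (Fin n) (Fin n) ℂ) *
      diagonal (fun i => (hA.eigenvalues i : ℂ)) *
      (star hA.eigenvectorUnitary : Matrix (Fin n) (Fin n) ℂ) := by
  conv_lhs => rw [hA.spectral_theorem]
  rfl

lemma IsHermitian.mpow_mul_mpow (hA : A.IsHermitian) (r s : ℝ) :
    mpow A r * mpow A s = (hA.eigenvectorUnitary : Matrix (Fin n) (Fin n) ℂ) *
      diagonal (fun i => ((hA.eigenvalues i ^ r * hA.eigenvalues i ^ s : ℝ) : ℂ)) *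
      (star hA.eigenvectorUnitary : Matrix (Fin n) (Fin n) ℂ) := by
  have hU : (star hA.eigenvectorUnitary : Matrix (Fin n) (Fin n) ℂ) *
      (hA.eigenvectorUnitary : Matrix (Fin n) (Fin n) ℂ) = 1 :=
    Unitary.coe_star_mul_self _
  rw [mpow, dif_pos hA, mpow, dif_pos hA]
  simp only [mul_assoc]
  rw [← mul_assoc (star _) _ (_ * _), hU, one_mul, ← mul_assoc (diagonal _) (diagonal _),
    diagonal_mul_diagonal]
  simp only [Complex.ofReal_mul]

lemma PosSemidef.posSemidef_mpow (hA : A.PosSemidef) (r : ℝ) : (mpow A r).PosSemidef := by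
  rw [mpow, dif_pos hA.isHermitian]
  refine (PosSemidef.diagonal fun i => ?_).mul_mul_conjTranspose_same _
  exact Complex.zero_le_real.mpr (Real.rpow_nonneg (hA.eigenvalues_nonneg i) r)

lemma PosSemidef.mpow_half_mul_self (hA : A.PosSemidef) :
    mpow A (1 / 2) * mpow A (1 / 2) = A := by
  rw [hA.isHermitian.mpow_mul_mpow]
  conv_rhs => rw [hA.isHermitian.eq_conj_diagonal]
  congr! 5 with i
  rw [← Real.sqrt_eq_rpow, Real.mul_self_sqrt (hA.eigenvalues_nonneg i)]

lemma PosDef.mpow_neg_mul (hA : A.PosDef) (r : ℝ) :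
    mpow A (-r) * mpow A r = 1 := by
  have h (i : Fin n) :
      hA.isHermitian.eigenvalues i ^ (-r) * hA.isHermitian.eigenvalues i ^ r = 1 := by
    rw [← Real.rpow_add (hA.eigenvalues_pos i), neg_add_cancel, Real.rpow_zero]
  rw [hA.isHermitian.mpow_mul_mpow]
  simp only [h, Complex.ofReal_one, diagonal_one, mul_one]
  exact Unitary.coe_mul_star_self _

lemma PosSemidef.mpow_half_conjTranspose_mul_self (hP : P.PosSemidef) :
    mpow (Pᴴ * P) (1 / 2) = P := by
  open scoped MatrixOrder Norms.L2Operator in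
  have h := posSemidef_conjTranspose_mul_self P
  have h1 := CFC.sqrt_unique h.mpow_half_mul_self (h.posSemidef_mpow (1 / 2)).nonneg
  have h2 := CFC.sqrt_unique (a := Pᴴ * P) (b := P) (by rw [hP.isHermitian.eq]) hP.nonneg
  rw [← h1, h2]

lemma PosSemidef.traceNorm_eq (hP : P.PosSemidef) : traceNorm P = P.trace.re := by
  rw [traceNorm, hP.mpow_half_conjTranspose_mul_self]

lemma re_trace_le_traceNorm (Y : Matrix (Fin n) (Fin n) ℂ) : Y.trace.re ≤ traceNorm Y := by
  have hS := posSemidef_conjTranspose_mul_self Y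
  set U : Matrix (Fin n) (Fin n) ℂ := (hS.isHermitian.eigenvectorUnitary).1
  have hUU : Uᴴ * U = 1 := Unitary.coe_star_mul_self _
  have hUU' : U * Uᴴ = 1 := Unitary.coe_mul_star_self _
  have hdiag := hS.isHermitian.eq_conj_diagonal
  set Z := Uᴴ * Y * U with hZ
  have hZZ : Zᴴ * Z = diagonal (fun i => (hS.isHermitian.eigenvalues i : ℂ)) := by
    calc Zᴴ * Z = Uᴴ * (Yᴴ * (U * Uᴴ) * Y) * U := by
          simp only [hZ, conjTranspose_mul, conjTranspose_conjTranspose, mul_assoc]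
      _ = Uᴴ * (Yᴴ * Y) * U := by rw [hUU', mul_one]
      _ = (Uᴴ * U) * diagonal (fun i => (hS.isHermitian.eigenvalues i : ℂ)) * (Uᴴ * U) := by
          conv_lhs => rw [hdiag]
          simp only [mul_assoc]; rfl
      _ = _ := by rw [hUU, one_mul, mul_one]
  have hentry (i : Fin n) : (Z i i).re ≤ hS.isHermitian.eigenvalues i ^ (1 / 2 : ℝ) := by
    rw [← Real.sqrt_eq_rpow]
    refine Real.le_sqrt_of_sq_le ?_
    have h := congrArg Complex.re (congrFun (congrFun hZZ i) i)
    rw [mul_apply, diagonal_apply_eq, Complex.ofReal_re, Complex.re_sum] at h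
    rw [← h]
    have hterm (j : Fin n) : (Zᴴ i j * Z j i).re = (Z j i).re ^ 2 + (Z j i).im ^ 2 := by
      simp [conjTranspose_apply]; ring
    simp only [hterm]
    refine le_trans ?_ (Finset.single_le_sum (fun j _ => by positivity) (Finset.mem_univ i))
    nlinarith [sq_nonneg (Z i i).im]
  have hY : Y.trace = Z.trace := by
    rw [hZ, mul_assoc, trace_mul_comm, mul_assoc, hUU', mul_one]
  have hT : (mpow (Yᴴ * Y) (1 / 2)).trace =
      ∑ i, ((hS.isHermitian.eigenvalues i ^ (1 / 2 : ℝ) : ℝ) : ℂ) := by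
    rw [mpow, dif_pos hS.isHermitian, trace_mul_comm, ← mul_assoc, Unitary.coe_star_mul_self,
      one_mul, trace_diagonal]
  rw [traceNorm, hT, hY, trace, Complex.re_sum, Complex.re_sum]
  exact Finset.sum_le_sum fun i _ => by simpa using hentry i

lemma PosSemidef.trace_mul_nonneg (hA : A.PosSemidef) (hB : B.PosSemidef) :
    0 ≤ (A * B).trace := by
  have h := (hB.mul_mul_conjTranspose_same (mpow A (1 / 2))).trace_nonneg
  rwa [(hA.posSemidef_mpow _).isHermitian.eq, trace_mul_comm, ← mul_assoc, hA.mpow_half_mul_self] at h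

/-- If `C * V * D` is positive semidefinite for positive semidefinite `C`, `D` and a unitary `V`,
then its trace is at most that of `C * D`. -/
lemma re_trace_mul_mul_le (hC : C.PosSemidef) (hD : D.PosSemidef) (hV : Vᴴ * V = 1)
    (hG : (C * V * D).PosSemidef) : (C * V * D).trace.re ≤ (C * D).trace.re := by
  set G := C * V * D with hGdef
  have hGD : D * Vᴴ * C = G := by
    rw [← hG.isHermitian.eq, hGdef]
    simp only [conjTranspose_mul, hC.isHermitian.eq, hD.isHermitian.eq, mul_assoc]
  have h1 := (Complex.le_def.mp
    (hC.trace_mul_nonneg (hD.mul_mul_conjTranspose_same (V - 1)))).1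
  have h2 := (Complex.le_def.mp (hG.conjTranspose_mul_mul_same (V - 1)).trace_nonneg).1
  have hV' : V * Vᴴ = 1 := mul_eq_one_comm.mp hV
  have e1 : (C * ((V - 1) * D * (V - 1)ᴴ)).trace =
      (G * Vᴴ).trace - G.trace - G.trace + (C * D).trace := by
    have : (C * (D * Vᴴ)).trace = G.trace := by rw [trace_mul_comm, hGD]
    nth_rewrite 2 [← this]
    simp only [hGdef, conjTranspose_sub, conjTranspose_one, ← trace_sub, ← trace_add]
    congr 1
    noncomm_ring
  have e2 : ((V - 1)ᴴ * G * (V - 1)).trace =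
      G.trace + G.trace - (G * V).trace - (Vᴴ * G).trace := by
    have : (Vᴴ * G * V).trace = G.trace := by
      rw [trace_mul_comm, ← mul_assoc, hV', one_mul]
    nth_rewrite 1 [← this]
    simp only [conjTranspose_sub, conjTranspose_one, ← trace_sub, ← trace_add]
    congr 1
    noncomm_ring
  have e3 : ((Vᴴ * G).trace).re = ((G * V).trace).re := by
    rw [← conjTranspose_conjTranspose (Vᴴ * G), trace_conjTranspose, conjTranspose_mul,
      conjTranspose_conjTranspose, hG.isHermitian.eq]
    exact Complex.conj_re _
  rw [e1] at h1
  rw [e2, trace_mul_comm Vᴴ] at h2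
  rw [trace_mul_comm Vᴴ] at e3
  simp only [Complex.zero_re, Complex.add_re, Complex.sub_re] at h1 h2
  linarith

lemma PosDef.posSemidef_geomMean (hA : A.PosDef) (hB : B.PosDef) (t : ℝ) :
    (geomMean A B t).PosSemidef := by
  have hC := (hA.posSemidef.posSemidef_mpow (1 / 2)).isHermitian.eq
  have hK := (hA.posSemidef.posSemidef_mpow (-(1 / 2))).isHermitian.eq
  have hM := hB.posSemidef.mul_mul_conjTranspose_same (mpow A (-(1 / 2)))
  rw [hK] at hM
  have := (hM.posSemidef_mpow t).mul_mul_conjTranspose_same (mpow A (1 / 2))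
  rwa [hC] at this

lemma PosDef.re_trace_geomMean_half_le (hA : A.PosDef) (hB : B.PosDef) :
    (geomMean A B (1 / 2)).trace.re ≤ (mpow A (1 / 2) * mpow B (1 / 2)).trace.re := by
  have hG := hA.posSemidef_geomMean hB (1 / 2)
  have hK := hA.posSemidef.posSemidef_mpow (-(1 / 2))
  have hM := hB.posSemidef.mul_mul_conjTranspose_same (mpow A (-(1 / 2)))
  rw [hK.isHermitian.eq] at hM
  have hEE := hM.mpow_half_mul_self
  have hKC := hA.mpow_neg_mul (1 / 2)
  have hLD := hB.mpow_neg_mul (1 / 2)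
  have hDD := hB.posSemidef.mpow_half_mul_self
  have hC := hA.posSemidef.posSemidef_mpow (1 / 2)
  have hD := hB.posSemidef.posSemidef_mpow (1 / 2)
  have hL := hB.posSemidef.posSemidef_mpow (-(1 / 2))
  have hE := hM.posSemidef_mpow (1 / 2)
  rw [geomMean] at hG ⊢
  set C := mpow A (1 / 2)
  set D := mpow B (1 / 2)
  set K := mpow A (-(1 / 2))
  set L := mpow B (-(1 / 2))
  set E := mpow (K * B * K) (1 / 2)
  have hCK : C * K = 1 := mul_eq_one_comm.mp hKC
  have hDL : D * L = 1 := mul_eq_one_comm.mp hLD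
  have hV : (E * C * L)ᴴ * (E * C * L) = 1 := by
    simp only [conjTranspose_mul, hE.isHermitian.eq, hC.isHermitian.eq, hL.isHermitian.eq]
    calc L * (C * E) * (E * C * L) = L * C * (E * E) * C * L := by noncomm_ring
      _ = L * (C * K) * (D * D) * (K * C) * L := by rw [hEE, hDD]; noncomm_ring
      _ = (L * D) * (D * L) := by rw [hCK, hKC]; noncomm_ring
      _ = 1 := by rw [hLD, hDL, one_mul]
  have hCVD : C * (E * C * L) * D = C * E * C := by
    calc C * (E * C * L) * D = C * E * C * (L * D) := by noncomm_ring
      _ = C * E * C := by rw [hLD, mul_one]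
  rw [← hCVD] at hG ⊢
  exact re_trace_mul_mul_le hC hD hV hG

end Matrix

/-- `‖((1-s)/2)(A+B) + s(A♯B)‖₁ ≤ ‖((1-s)/2)(A+B) + s A^{1/2}B^{1/2}‖₁`. -/
theorem stmt_12 {n : ℕ} (A B : Matrix (Fin n) (Fin n) ℂ)
    (hA : A.PosDef) (hB : B.PosDef) (s : ℝ) (hs : s ∈ Set.Icc (0:ℝ) 1) :
    traceNorm (((1 - s) / 2) • (A + B) + s • geomMean A B (1/2)) ≤
      traceNorm (((1 - s) / 2) • (A + B) + s • (mpow A (1/2) * mpow B (1/2))) := by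
  have h0 : 0 ≤ (1 - s) / 2 := by linarith [hs.2]
  have hP : (((1 - s) / 2) • (A + B) + s • geomMean A B (1/2)).PosSemidef :=
    ((hA.posSemidef.add hB.posSemidef).smul h0).add
      ((hA.posSemidef_geomMean hB (1 / 2)).smul hs.1)
  rw [hP.traceNorm_eq]
  refine le_trans ?_ (Matrix.re_trace_le_traceNorm _)
  simp only [Matrix.trace_add, Matrix.trace_smul, Complex.add_re, Complex.real_smul,
    Complex.re_ofReal_mul]
  linarith [mul_le_mul_of_nonneg_left (hA.re_trace_geomMean_half_le hB) hs.1]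
end

section
/- There exist 2×2 Hermitian complex matrices X, Y and a 2×2 positive semidefinite matrix Z such that X and Z − X are positive semidefinite, Z − Y is positive semidefinite, X and Y have the same singular values, yet the largest singular value of Z^{1/2} X Z^{1/2} strictly exceeds the largest singular value of Z^{1/2} Y Z^{1/2}; in particular, the singular values of Z^{1/2} X Z^{1/2} are not weakly majorized by those of Z^{1/2} Y Z^{1/2}. (A witness is X = I, Y = [[0,1],[1,0]], Z = diag(1,4).) -/
open Matrix ComplexOrder

/-- The singular values of a complex matrix, in decreasing order: the eigenvalues of
`(M*M)^{1/2}` in decreasing order. -/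
noncomputable def singVals {n : ℕ} (M : Matrix (Fin n) (Fin n) ℂ) : Fin n → ℝ :=
  eigsDesc (mpow (Mᴴ * M) (1/2))

/-- The square root of `A` given by `mpow` is its unique positive semidefinite square root. -/
lemma mpow_half_eq_of_mul_self {n : ℕ} {A B : Matrix (Fin n) (Fin n) ℂ}
    (hB : B.PosSemidef) (hBA : B * B = A) : mpow A (1 / 2) = B := by
  have hA : A.PosSemidef := by
    have h := Matrix.posSemidef_conjTranspose_mul_self B
    rwa [hB.isHermitian.eq, hBA] at h
  have hdef : mpow A (1 / 2) = (hA.isHermitian.eigenvectorUnitary : Matrix (Fin n) (Fin n) ℂ) *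
      Matrix.diagonal (fun i => ((hA.isHermitian.eigenvalues i ^ (1 / 2 : ℝ) : ℝ) : ℂ)) *
      (star hA.isHermitian.eigenvectorUnitary : Matrix (Fin n) (Fin n) ℂ) := by
    rw [mpow, dif_pos hA.isHermitian]
  have hpsd : (mpow A (1 / 2)).PosSemidef := by
    rw [hdef]
    refine Matrix.PosSemidef.mul_mul_conjTranspose_same (Matrix.PosSemidef.diagonal ?_) _
    intro i
    exact Complex.zero_le_real.mpr (Real.rpow_nonneg (hA.eigenvalues_nonneg i) _)
  have hsq : mpow A (1 / 2) * mpow A (1 / 2) = A := by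
    conv_rhs => rw [hA.isHermitian.spectral_theorem, Unitary.conjStarAlgAut_apply]
    have hU : (star hA.isHermitian.eigenvectorUnitary : Matrix (Fin n) (Fin n) ℂ) *
        (hA.isHermitian.eigenvectorUnitary : Matrix (Fin n) (Fin n) ℂ) = 1 :=
      Unitary.coe_star_mul_self _
    have hD : Matrix.diagonal (fun i => ((hA.isHermitian.eigenvalues i ^ (1 / 2 : ℝ) : ℝ) : ℂ)) *
        Matrix.diagonal (fun i => ((hA.isHermitian.eigenvalues i ^ (1 / 2 : ℝ) : ℝ) : ℂ)) =
        Matrix.diagonal (RCLike.ofReal ∘ hA.isHermitian.eigenvalues) := by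
      rw [Matrix.diagonal_mul_diagonal]
      congr 1
      ext i
      rw [← Complex.ofReal_mul, ← Real.sqrt_eq_rpow,
        Real.mul_self_sqrt (hA.eigenvalues_nonneg i)]
      rfl
    rw [hdef, ← hD]
    simp only [Matrix.mul_assoc]
    rw [← Matrix.mul_assoc (star _) _ (_ * _), hU, Matrix.one_mul]
  open scoped MatrixOrder Matrix.Norms.L2Operator in
  exact (CFC.mul_self_eq_mul_self_iff _ _ hpsd.nonneg hB.nonneg).mp (hsq.trans hBA.symm)

lemma eigsDesc_fin_two {M : Matrix (Fin 2) (Fin 2) ℂ} (hM : M.IsHermitian) {a b : ℝ}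
    (hab : b ≤ a) (htr : M.trace = a + b) (hdet : M.det = a * b) :
    eigsDesc M = ![a, b] := by
  have hle : eigsDesc M 1 ≤ eigsDesc M 0 := by
    simp only [eigsDesc, dif_pos hM]
    exact Tuple.monotone_sort hM.eigenvalues (by decide : Fin.rev (1 : Fin 2) ≤ Fin.rev 0)
  have hperm : ∀ i, eigsDesc M i =
      hM.eigenvalues ((Fin.revPerm.trans (Tuple.sort hM.eigenvalues)) i) := by
    intro i
    simp [eigsDesc, dif_pos hM]
  have hsum : eigsDesc M 0 + eigsDesc M 1 = a + b := by
    rw [← Fin.sum_univ_two (eigsDesc M), Finset.sum_congr rfl fun i _ => hperm i,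
      Equiv.sum_comp _ hM.eigenvalues]
    rw [hM.trace_eq_sum_eigenvalues] at htr
    exact Complex.ofReal_injective (by push_cast; exact htr)
  have hprod : eigsDesc M 0 * eigsDesc M 1 = a * b := by
    rw [← Fin.prod_univ_two (eigsDesc M), Finset.prod_congr rfl fun i _ => hperm i,
      Equiv.prod_comp _ hM.eigenvalues]
    rw [hM.det_eq_prod_eigenvalues] at hdet
    exact Complex.ofReal_injective (by push_cast; exact hdet)
  have h0 : eigsDesc M 0 = a := by
    have hroot : (eigsDesc M 0 - a) * (eigsDesc M 0 - b) = 0 := by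
      linear_combination eigsDesc M 0 * hsum - hprod
    rcases mul_eq_zero.mp hroot with h | h <;> linarith
  ext i
  fin_cases i
  · exact h0
  · change eigsDesc M 1 = b
    linarith

lemma singVals_fin_two {M B : Matrix (Fin 2) (Fin 2) ℂ} (hB : B.PosSemidef)
    (hBM : B * B = Mᴴ * M) {a b : ℝ} (hab : b ≤ a) (htr : B.trace = a + b)
    (hdet : B.det = a * b) : singVals M = ![a, b] := by
  rw [singVals, mpow_half_eq_of_mul_self hB hBM]
  exact eigsDesc_fin_two hB.isHermitian hab htr hdet

lemma posSemidef_diagonal_fin_two {a b : ℝ} (ha : 0 ≤ a) (hb : 0 ≤ b) :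
    (!![(a : ℂ), 0; 0, (b : ℂ)]).PosSemidef := by
  have h : (Matrix.diagonal ![(a : ℂ), (b : ℂ)]).PosSemidef := by
    refine Matrix.PosSemidef.diagonal ?_
    intro i
    fin_cases i <;> simpa
  simpa [Matrix.diagonal_fin_two] using h

/-- there are 2×2 Hermitian `X, Y` and PSD `Z` with
`0 ≤ X ≤ Z`, `Y ≤ Z`, `X` and `Y` having the same singular values, yet the largest
singular value of `Z^{1/2} X Z^{1/2}` strictly exceeds that of `Z^{1/2} Y Z^{1/2}`;
in particular the singular values of `Z^{1/2} X Z^{1/2}` are not weakly majorized by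
those of `Z^{1/2} Y Z^{1/2}`. -/
theorem stmt_14 :
    ∃ X Y Z : Matrix (Fin 2) (Fin 2) ℂ,
      X.IsHermitian ∧ Y.IsHermitian ∧ Z.PosSemidef ∧
      X.PosSemidef ∧ (Z - X).PosSemidef ∧ (Z - Y).PosSemidef ∧
      (∀ i, singVals X i = singVals Y i) ∧
      singVals (mpow Z (1/2) * Y * mpow Z (1/2)) 0 <
        singVals (mpow Z (1/2) * X * mpow Z (1/2)) 0 ∧
      ¬ (singVals (mpow Z (1/2) * X * mpow Z (1/2)) 0 ≤
            singVals (mpow Z (1/2) * Y * mpow Z (1/2)) 0 ∧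
          singVals (mpow Z (1/2) * X * mpow Z (1/2)) 0 +
              singVals (mpow Z (1/2) * X * mpow Z (1/2)) 1 ≤
            singVals (mpow Z (1/2) * Y * mpow Z (1/2)) 0 +
              singVals (mpow Z (1/2) * Y * mpow Z (1/2)) 1) := by
  have h1 : (!![1, 0; 0, 1] : Matrix (Fin 2) (Fin 2) ℂ).PosSemidef := by
    simpa using posSemidef_diagonal_fin_two zero_le_one zero_le_one
  have h14 : (!![1, 0; 0, 4] : Matrix (Fin 2) (Fin 2) ℂ).PosSemidef := by
    simpa using posSemidef_diagonal_fin_two (b := 4) zero_le_one (by norm_num)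
  have h12 : (!![1, 0; 0, 2] : Matrix (Fin 2) (Fin 2) ℂ).PosSemidef := by
    simpa using posSemidef_diagonal_fin_two (b := 2) zero_le_one (by norm_num)
  have h22 : (!![2, 0; 0, 2] : Matrix (Fin 2) (Fin 2) ℂ).PosSemidef := by
    simpa using posSemidef_diagonal_fin_two (a := 2) (b := 2) (by norm_num) (by norm_num)
  have h03 : (!![0, 0; 0, 3] : Matrix (Fin 2) (Fin 2) ℂ).PosSemidef := by
    simpa using posSemidef_diagonal_fin_two (a := 0) (b := 3) (by norm_num) (by norm_num)
  have hZ : mpow !![1, 0; 0, 4] (1 / 2) = !![1, 0; 0, 2] :=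
    mpow_half_eq_of_mul_self h12 (by norm_num [Matrix.mul_fin_two])
  have hX : singVals !![1, 0; 0, 1] = ![1, 1] :=
    singVals_fin_two h1 (by rw [h1.isHermitian.eq]) le_rfl
      (by norm_num [Matrix.trace_fin_two]) (by norm_num [Matrix.det_fin_two])
  have hYH : (!![0, 1; 1, 0] : Matrix (Fin 2) (Fin 2) ℂ).IsHermitian := by
    ext i j
    fin_cases i <;> fin_cases j <;> simp
  have hY : singVals !![0, 1; 1, 0] = ![1, 1] :=
    singVals_fin_two h1 (by rw [hYH.eq]; norm_num [Matrix.mul_fin_two]) le_rfl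
      (by norm_num [Matrix.trace_fin_two]) (by norm_num [Matrix.det_fin_two])
  have hZX : singVals (mpow !![1, 0; 0, 4] (1 / 2) * !![1, 0; 0, 1] *
      mpow !![1, 0; 0, 4] (1 / 2)) = ![4, 1] := by
    have h : mpow !![1, 0; 0, 4] (1 / 2) * !![1, 0; 0, 1] * mpow !![1, 0; 0, 4] (1 / 2) =
        !![1, 0; 0, 4] := by
      rw [hZ]
      norm_num [Matrix.mul_fin_two]
    rw [h]
    exact singVals_fin_two h14 (by rw [h14.isHermitian.eq]) (by norm_num)
      (by norm_num [Matrix.trace_fin_two]) (by norm_num [Matrix.det_fin_two])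
  have hZY : singVals (mpow !![1, 0; 0, 4] (1 / 2) * !![0, 1; 1, 0] *
      mpow !![1, 0; 0, 4] (1 / 2)) = ![2, 2] := by
    have h : mpow !![1, 0; 0, 4] (1 / 2) * !![0, 1; 1, 0] * mpow !![1, 0; 0, 4] (1 / 2) =
        (2 : ℝ) • !![0, 1; 1, 0] := by
      rw [hZ]
      norm_num [Matrix.mul_fin_two]
    rw [h]
    refine singVals_fin_two h22 ?_ le_rfl
      (by norm_num [Matrix.trace_fin_two]) (by norm_num [Matrix.det_fin_two])
    rw [Matrix.conjTranspose_smul, hYH.eq]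
    norm_num [Matrix.mul_fin_two]
  have hZmY : (!![1, 0; 0, 4] - !![0, 1; 1, 0] : Matrix (Fin 2) (Fin 2) ℂ).PosSemidef := by
    have h := (Matrix.posSemidef_conjTranspose_mul_self
      (!![1, -1; 0, 0] : Matrix (Fin 2) (Fin 2) ℂ)).add h03
    convert h using 1
    ext i j
    fin_cases i <;> fin_cases j <;> norm_num [Matrix.mul_apply]
  have hZmX : (!![1, 0; 0, 4] - !![1, 0; 0, 1] : Matrix (Fin 2) (Fin 2) ℂ).PosSemidef := by
    convert h03 using 1
    ext i j
    fin_cases i <;> fin_cases j <;> norm_num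
  refine ⟨!![1, 0; 0, 1], !![0, 1; 1, 0], !![1, 0; 0, 4], h1.isHermitian, hYH, h14, h1,
    hZmX, hZmY, fun i => by rw [hX, hY], ?_, ?_⟩
  · rw [hZX, hZY]
    norm_num
  · rw [hZX, hZY]
    norm_num
end

section
/- Let A and B be n×n positive definite complex matrices and t ∈ [0,1]. Then det(I + A♯_t B) ≤ det(I + A^{1−t} B^t), where both determinants are real and positive (the right-hand side since A^{1−t}B^t is similar to the positive definite matrix B^{t/2}A^{1−t}B^{t/2}). -/
open Matrix ComplexOrder

/-- The `k`-th compound matrix: the matrix of the `k`-th exterior power. -/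
noncomputable def compound {n : ℕ} (k : ℕ) (M : Matrix (Fin n) (Fin n) ℂ) :
    Matrix (Set.powersetCard (Fin n) k) (Set.powersetCard (Fin n) k) ℂ :=
  LinearMap.toMatrix ((Pi.basisFun ℂ (Fin n)).exteriorPower k)
    ((Pi.basisFun ℂ (Fin n)).exteriorPower k) (exteriorPower.map k (Matrix.toLin' M))

theorem compound_apply {n : ℕ} (k : ℕ) (M : Matrix (Fin n) (Fin n) ℂ)
    (s t : Set.powersetCard (Fin n) k) :
    compound k M s t = (M.submatrix (Set.powersetCard.ofFinEmbEquiv.symm s)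
      (Set.powersetCard.ofFinEmbEquiv.symm t)).det := by
  rw [compound, LinearMap.toMatrix_apply, exteriorPower.coe_basis,
    exteriorPower.map_apply_ιMulti_family, exteriorPower.basis_repr_apply,
    exteriorPower.ιMulti_family, exteriorPower.ιMultiDual_apply_ιMulti, ← det_transpose]
  congr 1
  ext i j
  simp

theorem compound_mul {n : ℕ} (k : ℕ) (M N : Matrix (Fin n) (Fin n) ℂ) :
    compound k (M * N) = compound k M * compound k N := by
  rw [compound, Matrix.toLin'_mul, exteriorPower.map_comp,
    LinearMap.toMatrix_comp _ ((Pi.basisFun ℂ (Fin n)).exteriorPower k)]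
  rfl

theorem compound_conjTranspose {n : ℕ} (k : ℕ) (M : Matrix (Fin n) (Fin n) ℂ) :
    compound k Mᴴ = (compound k M)ᴴ := by
  ext s t
  rw [conjTranspose_apply, compound_apply, compound_apply, ← det_conjTranspose,
    conjTranspose_submatrix]

theorem compound_diagonal {n : ℕ} (k : ℕ) (d : Fin n → ℂ) :
    compound k (diagonal d) = diagonal fun s => ∏ i ∈ s.val, d i := by
  have key (s : Set.powersetCard (Fin n) k) :
      exteriorPower.map k (Matrix.toLin' (diagonal d))
        (exteriorPower.ιMulti_family ℂ k (Pi.basisFun ℂ (Fin n)) s) =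
      (∏ i ∈ (s : Finset (Fin n)), d i) •
        exteriorPower.ιMulti_family ℂ k (Pi.basisFun ℂ (Fin n)) s := by
    rw [exteriorPower.map_apply_ιMulti_family]
    have h : (Matrix.toLin' (diagonal d)) ∘ (Pi.basisFun ℂ (Fin n)) =
        fun i => d i • Pi.basisFun ℂ (Fin n) i := by
      ext i j
      by_cases hij : i = j
      · subst hij; simp [mulVec_diagonal]
      · simp [mulVec_diagonal, hij]
    have hp : ∏ i ∈ (s : Finset (Fin n)), d i =
        ∏ i : Fin k, d (Set.powersetCard.ofFinEmbEquiv.symm s i) := by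
      rw [← Finset.prod_coe_sort]
      exact (Fintype.prod_equiv (Set.powersetCard.orderIsoOfFin s).toEquiv _ _ fun _ => rfl).symm
    rw [h, hp]
    exact (exteriorPower.ιMulti ℂ k).map_smul_univ
      (fun i => d (Set.powersetCard.ofFinEmbEquiv.symm s i))
      (fun i => Pi.basisFun ℂ (Fin n) (Set.powersetCard.ofFinEmbEquiv.symm s i))
  ext s t
  rw [compound, LinearMap.toMatrix_apply, exteriorPower.coe_basis, key, map_smul,
    exteriorPower.basis_repr, Finsupp.smul_apply, diagonal_apply]
  by_cases hst : s = t
  · subst hst; simp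
  · simp [hst]

theorem compound_one {n : ℕ} (k : ℕ) : compound k (1 : Matrix (Fin n) (Fin n) ℂ) = 1 := by
  rw [← diagonal_one, compound_diagonal]
  simp

theorem det_one_add_diagonal_eq_sum_trace_compound {n : ℕ} (d : Fin n → ℂ) :
    (1 + diagonal d).det = ∑ k ∈ Finset.range (n + 1), (compound k (diagonal d)).trace := by
  simp_rw [compound_diagonal, trace_diagonal]
  rw [← diagonal_one, diagonal_add, det_diagonal, Finset.prod_one_add, Finset.sum_powerset,
    Finset.card_univ, Fintype.card_fin]
  refine Finset.sum_congr rfl fun k _ => ?_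
  refine (Finset.sum_subtype _ (fun s => ?_) _)
  simp [Set.powersetCard.mem_iff]

theorem det_one_add_eq_sum_trace_compound_comm {n : ℕ} (M N : Matrix (Fin n) (Fin n) ℂ)
    (h : (1 + M * N).det = ∑ k ∈ Finset.range (n + 1), (compound k (M * N)).trace) :
    (1 + N * M).det = ∑ k ∈ Finset.range (n + 1), (compound k (N * M)).trace := by
  rw [det_one_add_mul_comm, h]
  refine Finset.sum_congr rfl fun k _ => ?_
  rw [compound_mul, compound_mul, trace_mul_comm]

theorem Matrix.IsHermitian.det_one_add_eq_sum_trace_compound {n : ℕ}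
    {M : Matrix (Fin n) (Fin n) ℂ} (hM : M.IsHermitian) :
    (1 + M).det = ∑ k ∈ Finset.range (n + 1), (compound k M).trace := by
  have h := hM.spectral_theorem
  rw [Unitary.conjStarAlgAut_apply, mul_assoc] at h
  rw [h]
  apply det_one_add_eq_sum_trace_compound_comm
  rw [mul_assoc, Unitary.coe_star_mul_self, mul_one]
  exact det_one_add_diagonal_eq_sum_trace_compound _

theorem trace_mul_diagonal_mul_conjTranspose {ι : Type*} [Fintype ι] [DecidableEq ι]
    (X Z : Matrix ι ι ℂ) (d : ι → ℂ) :
    (X * diagonal d * Zᴴ).trace = ∑ k, ∑ j, d j * (X k j * star (Z k j)) := by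
  simp only [trace, diag_apply]
  refine Finset.sum_congr rfl fun k _ => ?_
  rw [mul_apply]
  refine Finset.sum_congr rfl fun j _ => ?_
  rw [mul_diagonal, conjTranspose_apply]
  ring

theorem trace_resolvent_nonneg {ι : Type*} [Fintype ι] [DecidableEq ι]
    (M T Y A B D L : Matrix ι ι ℂ) (s : ℝ) (hs : 0 ≤ s) (hM : Mᴴ * M = 1)
    (hT : T * Tᴴ = A) (hN : M * T * L * (M * T)ᴴ = B) (hL : L.PosSemidef) (hD : D.IsHermitian)
    (hLD : (s : ℂ) • D + D * L = 1) (hLD' : (s : ℂ) • D + L * D = 1) :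
    0 ≤ (T * D * Tᴴ).trace - (M * A * Yᴴ).trace - (Y * A * Mᴴ).trace
      + s * (Y * A * Yᴴ).trace + (Yᴴ * B * Y).trace := by
  have hp : ((s : ℂ) • ((M * T * D - Y * T) * (M * T * D - Y * T)ᴴ)
      + (T * D - Yᴴ * (M * T)) * L * (T * D - Yᴴ * (M * T))ᴴ).PosSemidef :=
    ((posSemidef_self_mul_conjTranspose _).smul (by exact_mod_cast hs)).add
      (hL.mul_mul_conjTranspose_same _)
  convert hp.trace_nonneg using 1
  have h1 : (M * T * D * (M * T * D)ᴴ).trace = (T * (D * D) * Tᴴ).trace := by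
    rw [conjTranspose_mul, conjTranspose_mul, hD.eq, ← mul_assoc, ← mul_assoc, trace_mul_comm]
    simp only [← mul_assoc, hM, one_mul]
  have e1 : (T * D * Tᴴ).trace = s * (T * (D * D) * Tᴴ).trace + (T * (D * L * D) * Tᴴ).trace := by
    have : D = (s : ℂ) • (D * D) + D * L * D := by
      calc D = ((s : ℂ) • D + D * L) * D := by rw [hLD, one_mul]
        _ = _ := by rw [add_mul, smul_mul_assoc]
    conv_lhs => rw [this]
    simp [mul_add, add_mul]
  have e2 : (M * A * Yᴴ).trace =
      s * (M * T * D * (Y * T)ᴴ).trace + (Yᴴ * (M * T) * L * (T * D)ᴴ).trace := by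
    have : (Yᴴ * (M * T) * L * (T * D)ᴴ).trace = (M * T * (L * D) * Tᴴ * Yᴴ).trace := by
      rw [conjTranspose_mul, hD.eq, trace_mul_comm _ Yᴴ]
      simp only [mul_assoc]
    have hsplit : M * (T * Tᴴ) * Yᴴ =
        (s : ℂ) • (M * T * D * (Y * T)ᴴ) + M * T * (L * D) * Tᴴ * Yᴴ := by
      calc M * (T * Tᴴ) * Yᴴ = M * T * ((s : ℂ) • D + L * D) * Tᴴ * Yᴴ := by
            rw [hLD', mul_one]; simp only [mul_assoc]
        _ = _ := by simp [mul_add, add_mul, mul_assoc]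
    rw [this, ← hT, hsplit, trace_add, trace_smul, smul_eq_mul]
  have e3 : (Y * A * Mᴴ).trace =
      s * (Y * T * (M * T * D)ᴴ).trace + (T * D * L * (Yᴴ * (M * T))ᴴ).trace := by
    have : (T * D * L * (Yᴴ * (M * T))ᴴ).trace = (Y * T * (D * L) * Tᴴ * Mᴴ).trace := by
      rw [conjTranspose_mul, conjTranspose_conjTranspose, ← mul_assoc, trace_mul_comm _ Y]
      simp only [conjTranspose_mul, mul_assoc]
    have hsplit : Y * (T * Tᴴ) * Mᴴ =
        (s : ℂ) • (Y * T * (M * T * D)ᴴ) + Y * T * (D * L) * Tᴴ * Mᴴ := by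
      calc Y * (T * Tᴴ) * Mᴴ = Y * T * ((s : ℂ) • D + D * L) * Tᴴ * Mᴴ := by
            rw [hLD, mul_one]; simp only [mul_assoc]
        _ = _ := by simp [mul_add, add_mul, mul_assoc, hD.eq]
    rw [this, ← hT, hsplit, trace_add, trace_smul, smul_eq_mul]
  rw [e1, e2, e3, ← h1, ← hT, ← hN]
  have h4 : (T * D * L * (T * D)ᴴ).trace = (T * (D * L * D) * Tᴴ).trace := by
    rw [conjTranspose_mul, hD.eq]; simp only [mul_assoc]
  have h5 : (Y * T * (Y * T)ᴴ).trace = (Y * (T * Tᴴ) * Yᴴ).trace := by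
    rw [conjTranspose_mul]; simp only [mul_assoc]
  have h6 : (Yᴴ * (M * T) * L * (Yᴴ * (M * T))ᴴ).trace =
      (Yᴴ * (M * T * L * (M * T)ᴴ) * Y).trace := by
    rw [conjTranspose_mul, conjTranspose_conjTranspose]; simp only [mul_assoc]
  rw [← h4, ← h5, ← h6]
  simp only [conjTranspose_sub, mul_sub, sub_mul, trace_add, trace_sub, trace_smul, smul_eq_mul]
  ring

theorem integrableOn_sum_mul_rpowIntegrand {γ : Type*} (K : Finset γ) (w z : γ → ℝ)
    (hz : ∀ i ∈ K, 0 < z i) {t : ℝ} (ht : t ∈ Set.Ioo (0 : ℝ) 1) :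
    MeasureTheory.IntegrableOn (fun s => ∑ i ∈ K, w i * Real.rpowIntegrand₀₁ t s (z i))
      (Set.Ioi 0) :=
  MeasureTheory.integrable_finsetSum _ fun i hi =>
    (Real.integrableOn_rpowIntegrand₀₁_Ioi ht (hz i hi).le).const_mul _

theorem sum_mul_rpow_mul_integral {γ : Type*} (K : Finset γ) (w z : γ → ℝ)
    (hz : ∀ i ∈ K, 0 < z i) {t : ℝ} (ht : t ∈ Set.Ioo (0 : ℝ) 1) :
    (∑ i ∈ K, w i * z i ^ t) * ∫ s in Set.Ioi 0, Real.rpowIntegrand₀₁ t s 1 =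
      ∫ s in Set.Ioi 0, ∑ i ∈ K, w i * Real.rpowIntegrand₀₁ t s (z i) := by
  rw [MeasureTheory.integral_finsetSum, Finset.sum_mul]
  · refine Finset.sum_congr rfl fun i hi => ?_
    rw [MeasureTheory.integral_const_mul,
      Real.integral_rpowIntegrand₀₁_eq_rpow_mul_const ht (hz i hi).le, mul_assoc]
  · exact fun i hi => (Real.integrableOn_rpowIntegrand₀₁_Ioi ht (hz i hi).le).const_mul _

theorem sum_mul_rpowIntegrand {γ : Type*} (K : Finset γ) (w z : γ → ℝ) (t s : ℝ) :
    ∑ i ∈ K, w i * Real.rpowIntegrand₀₁ t s (z i) =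
      s ^ t * (s⁻¹ * ∑ i ∈ K, w i - ∑ i ∈ K, w i * (s + z i)⁻¹) := by
  rw [Finset.mul_sum, ← Finset.sum_sub_distrib, Finset.mul_sum]
  refine Finset.sum_congr rfl fun i _ => ?_
  rw [Real.rpowIntegrand₀₁]
  ring

theorem sum_mul_rpow_le_of_resolvent_le {α β : Type*} (I : Finset α) (J : Finset β)
    (p x : α → ℝ) (q y : β → ℝ) (hx : ∀ i ∈ I, 0 < x i) (hy : ∀ j ∈ J, 0 < y j)
    (h0 : ∑ i ∈ I, p i = ∑ j ∈ J, q j)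
    (hs : ∀ s : ℝ, 0 < s → ∑ j ∈ J, q j * (s + y j)⁻¹ ≤ ∑ i ∈ I, p i * (s + x i)⁻¹)
    {t : ℝ} (ht : t ∈ Set.Ioo (0 : ℝ) 1) :
    ∑ i ∈ I, p i * x i ^ t ≤ ∑ j ∈ J, q j * y j ^ t := by
  refine le_of_mul_le_mul_right ?_ (Real.integral_rpowIntegrand₀₁_one_pos ht)
  rw [sum_mul_rpow_mul_integral I p x hx ht, sum_mul_rpow_mul_integral J q y hy ht]
  refine MeasureTheory.setIntegral_mono_on (integrableOn_sum_mul_rpowIntegrand I p x hx ht)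
    (integrableOn_sum_mul_rpowIntegrand J q y hy ht) measurableSet_Ioi ?_
  intro s hs0
  have hs0 : 0 < s := hs0
  rw [sum_mul_rpowIntegrand, sum_mul_rpowIntegrand, h0]
  gcongr
  exact hs s hs0

theorem trace_mul_diagonal_mul_conjTranspose_self {ι : Type*} [Fintype ι] [DecidableEq ι]
    (X : Matrix ι ι ℂ) (d : ι → ℝ) :
    (X * diagonal (fun i => (d i : ℂ)) * Xᴴ).trace =
      ((∑ k, ∑ j, d j * ‖X k j‖ ^ 2 : ℝ) : ℂ) := by
  rw [trace_mul_diagonal_mul_conjTranspose]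
  push_cast
  simp_rw [Complex.star_def, Complex.mul_conj']

theorem resolvent_sum_le {ι : Type*} [Fintype ι] [DecidableEq ι]
    (M T : Matrix ι ι ℂ) (a b l : ι → ℝ) (ha : ∀ i, 0 < a i) (hb : ∀ i, 0 < b i)
    (hl : ∀ i, 0 < l i) (hM : Mᴴ * M = 1)
    (hT : T * Tᴴ = diagonal fun i => (a i : ℂ))
    (hN : M * T * diagonal (fun i => (l i : ℂ)) * (M * T)ᴴ = diagonal fun i => (b i : ℂ))
    {s : ℝ} (hs : 0 < s) :
    ∑ k, ∑ j, a j * ‖M k j‖ ^ 2 * (s + b k / a j)⁻¹ ≤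
      ∑ k, ∑ j, (s + l j)⁻¹ * ‖T k j‖ ^ 2 := by
  set Y : Matrix ι ι ℂ := of fun k j => ((a j / (b k + s * a j) : ℝ) : ℂ) * M k j with hY
  have hden (k j : ι) : 0 < b k + s * a j := by have := hb k; have := ha j; positivity
  have hinv (k j : ι) : (s + b k / a j)⁻¹ = a j / (b k + s * a j) := by
    have := ha j
    have := hb k
    rw [inv_eq_one_div, div_eq_div_iff (by positivity) (hden k j).ne']
    field_simp
    ring
  have hsl (i : ι) : s + l i ≠ 0 := by have := hl i; positivity
  have hslc (i : ι) : (s : ℂ) + l i ≠ 0 := by exact_mod_cast hsl i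
  have h := trace_resolvent_nonneg M T Y _ _ (diagonal fun i => (((s + l i)⁻¹ : ℝ) : ℂ))
    (diagonal fun i => (l i : ℂ)) s hs.le hM hT hN
    (posSemidef_diagonal_iff.mpr fun i => by exact_mod_cast (hl i).le)
    (by simp [IsHermitian, diagonal_conjTranspose, Pi.star_def])
    (by
      rw [diagonal_mul_diagonal, ← diagonal_smul, diagonal_add, ← diagonal_one]
      congr 1; ext i
      have := hslc i
      simp only [Pi.smul_apply, smul_eq_mul]; push_cast; field_simp)
    (by
      rw [diagonal_mul_diagonal, ← diagonal_smul, diagonal_add, ← diagonal_one]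
      congr 1; ext i
      have := hslc i
      simp only [Pi.smul_apply, smul_eq_mul]; push_cast; field_simp)
  have hQ1 : (M * diagonal (fun i => (a i : ℂ)) * Yᴴ).trace =
      ((∑ k, ∑ j, a j * ‖M k j‖ ^ 2 * (s + b k / a j)⁻¹ : ℝ) : ℂ) := by
    rw [trace_mul_diagonal_mul_conjTranspose, Complex.ofReal_sum]
    refine Finset.sum_congr rfl fun k _ => ?_
    rw [Complex.ofReal_sum]
    refine Finset.sum_congr rfl fun j _ => ?_
    rw [hinv, hY, of_apply, star_mul', Complex.star_def, Complex.conj_ofReal,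
      mul_left_comm (M k j), Complex.mul_conj']
    push_cast
    ring
  have hQ2 : (Y * diagonal (fun i => (a i : ℂ)) * Mᴴ).trace =
      ((∑ k, ∑ j, a j * ‖M k j‖ ^ 2 * (s + b k / a j)⁻¹ : ℝ) : ℂ) := by
    have := congrArg star hQ1
    rw [← trace_conjTranspose, conjTranspose_mul, conjTranspose_mul, conjTranspose_conjTranspose,
      diagonal_conjTranspose, Complex.star_def, Complex.conj_ofReal, ← mul_assoc] at this
    rw [← this]
    congr
    ext i
    simp
  have hY1 := trace_mul_diagonal_mul_conjTranspose_self Y a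
  have hY2 := trace_mul_diagonal_mul_conjTranspose_self Yᴴ b
  rw [conjTranspose_conjTranspose] at hY2
  rw [hQ1, hQ2, hY1, hY2, trace_mul_diagonal_mul_conjTranspose_self] at h
  norm_cast at h
  have hYQ : s * (∑ k, ∑ j, a j * ‖Y k j‖ ^ 2) + ∑ j, ∑ k, b k * ‖Yᴴ j k‖ ^ 2 =
      ∑ k, ∑ j, a j * ‖M k j‖ ^ 2 * (s + b k / a j)⁻¹ := by
    rw [Finset.sum_comm (f := fun j k => b k * ‖Yᴴ j k‖ ^ 2), Finset.mul_sum,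
      ← Finset.sum_add_distrib]
    refine Finset.sum_congr rfl fun k _ => ?_
    rw [Finset.mul_sum, ← Finset.sum_add_distrib]
    refine Finset.sum_congr rfl fun j _ => ?_
    have h1 := (ha j).ne'
    have h2 := (hden k j).ne'
    have hn : ‖Y k j‖ = a j / (b k + s * a j) * ‖M k j‖ := by
      rw [hY, of_apply, norm_mul, Complex.norm_real, Real.norm_of_nonneg]
      exact (div_pos (ha j) (hden k j)).le
    rw [conjTranspose_apply, norm_star, hn, hinv]
    field_simp
    ring
  linarith

theorem sum_rpow_le_sum_rpow_mul_rpow {ι : Type*} [Fintype ι] [DecidableEq ι]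
    (M T : Matrix ι ι ℂ) (a b l : ι → ℝ) (ha : ∀ i, 0 < a i) (hb : ∀ i, 0 < b i)
    (hl : ∀ i, 0 < l i) (hM : Mᴴ * M = 1) (hM' : M * Mᴴ = 1)
    (hT : T * Tᴴ = diagonal fun i => (a i : ℂ))
    (hN : M * T * diagonal (fun i => (l i : ℂ)) * (M * T)ᴴ = diagonal fun i => (b i : ℂ))
    {t : ℝ} (ht : t ∈ Set.Icc (0 : ℝ) 1) :
    ∑ k, ∑ j, l j ^ t * ‖T k j‖ ^ 2 ≤ ∑ k, ∑ j, a j ^ (1 - t) * b k ^ t * ‖M k j‖ ^ 2 := by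
  have hmass : ∑ k, ∑ j, ‖T k j‖ ^ 2 = ∑ k, ∑ j, a j * ‖M k j‖ ^ 2 := by
    have h1 := trace_mul_diagonal_mul_conjTranspose_self T (fun _ => 1)
    have h2 := trace_mul_diagonal_mul_conjTranspose_self M a
    rw [mul_assoc, trace_mul_comm, mul_assoc, hM, mul_one, ← hT] at h2
    simp only [Complex.ofReal_one, diagonal_one, mul_one, one_mul] at h1
    exact_mod_cast h1.symm.trans h2
  rcases ht.1.eq_or_lt with rfl | ht0
  · simpa using hmass.le
  rcases ht.2.eq_or_lt with rfl | ht1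
  · have h1 := trace_mul_diagonal_mul_conjTranspose_self T l
    have h2 := trace_mul_diagonal_mul_conjTranspose_self Mᴴ b
    rw [mul_assoc, trace_mul_comm, mul_assoc, conjTranspose_conjTranspose, hM', mul_one, ← hN,
      conjTranspose_mul, trace_mul_comm] at h2
    have h3 : (Tᴴ * Mᴴ * (M * T * diagonal fun i => (l i : ℂ))).trace =
        (T * diagonal (fun i => (l i : ℂ)) * Tᴴ).trace := by
      rw [trace_mul_comm _ Tᴴ]
      simp only [← mul_assoc]
      rw [mul_assoc Tᴴ, hM, mul_one]
    rw [h3, h1, Complex.ofReal_inj, Finset.sum_comm (f := fun k j => b j * ‖Mᴴ k j‖ ^ 2)] at h2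
    simpa using h2.le
  · have h := sum_mul_rpow_le_of_resolvent_le (Finset.univ : Finset (ι × ι))
      (Finset.univ : Finset (ι × ι)) (fun i => ‖T i.1 i.2‖ ^ 2) (fun i => l i.2)
      (fun i => a i.2 * ‖M i.1 i.2‖ ^ 2) (fun i => b i.1 / a i.2)
      (fun i _ => hl _) (fun i _ => div_pos (hb _) (ha _))
      (by simpa only [Fintype.sum_prod_type] using hmass)
      (fun s hs => by
        have := resolvent_sum_le M T a b l ha hb hl hM hT hN hs
        simpa only [Fintype.sum_prod_type, mul_comm (‖T _ _‖ ^ 2)] using this) ⟨ht0, ht1⟩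
    simp only [Fintype.sum_prod_type, mul_comm (‖T _ _‖ ^ 2)] at h
    refine h.trans_eq ?_
    refine Finset.sum_congr rfl fun k _ => Finset.sum_congr rfl fun j _ => ?_
    rw [Real.div_rpow (hb k).le (ha j).le, Real.rpow_sub (ha j), Real.rpow_one]
    ring

theorem compound_diagonal_ofReal {n : ℕ} (k : ℕ) (d : Fin n → ℝ) :
    compound k (diagonal fun i => (d i : ℂ)) =
      diagonal fun s => ((∏ i ∈ s.val, d i : ℝ) : ℂ) := by
  rw [compound_diagonal]
  push_cast
  rfl

theorem compound_diagonal_rpow {n : ℕ} (k : ℕ) (d : Fin n → ℝ) (hd : ∀ i, 0 < d i) (r : ℝ) :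
    compound k (diagonal fun i => ((d i ^ r : ℝ) : ℂ)) =
      diagonal fun s => (((∏ i ∈ s.val, d i) ^ r : ℝ) : ℂ) := by
  simp_rw [compound_diagonal_ofReal, Real.finsetProd_rpow _ d (fun i _ => (hd i).le)]

theorem isHermitian_mul_diagonal_ofReal_mul_conjTranspose {ι : Type*} [Fintype ι] [DecidableEq ι]
    (X : Matrix ι ι ℂ) (d : ι → ℝ) : (X * diagonal (fun i => (d i : ℂ)) * Xᴴ).IsHermitian :=
  isHermitian_mul_mul_conjTranspose X (by simp [IsHermitian, diagonal_conjTranspose, Pi.star_def])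

theorem trace_diagonal_mul_conjTranspose_mul_diagonal_mul {ι : Type*} [Fintype ι] [DecidableEq ι]
    (M : Matrix ι ι ℂ) (a b : ι → ℝ) :
    (diagonal (fun i => (a i : ℂ)) * (Mᴴ * diagonal (fun i => (b i : ℂ)) * M)).trace =
      ((∑ k, ∑ j, a j * b k * ‖M k j‖ ^ 2 : ℝ) : ℂ) := by
  have h : (diagonal (fun i => (a i : ℂ)) * (Mᴴ * diagonal (fun i => (b i : ℂ)) * M)).trace =
      (M * diagonal (fun i => (a i : ℂ)) * (diagonal (fun i => (b i : ℂ)) * M)ᴴ).trace := by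
    rw [conjTranspose_mul, diagonal_conjTranspose, ← mul_assoc, trace_mul_comm _ M]
    simp only [mul_assoc]
    congr
    ext i
    simp
  rw [h, trace_mul_diagonal_mul_conjTranspose, Complex.ofReal_sum]
  refine Finset.sum_congr rfl fun k _ => ?_
  rw [Complex.ofReal_sum]
  refine Finset.sum_congr rfl fun j _ => ?_
  rw [diagonal_mul, star_mul', Complex.star_def, Complex.conj_ofReal,
    mul_left_comm (M k j), Complex.mul_conj']
  push_cast
  ring

theorem det_one_add_le_det_one_add {n : ℕ}
    (M T : Matrix (Fin n) (Fin n) ℂ) (a b l : Fin n → ℝ) (ha : ∀ i, 0 < a i) (hb : ∀ i, 0 < b i)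
    (hl : ∀ i, 0 < l i) (hM : Mᴴ * M = 1) (hM' : M * Mᴴ = 1)
    (hT : T * Tᴴ = diagonal fun i => (a i : ℂ))
    (hN : M * T * diagonal (fun i => (l i : ℂ)) * (M * T)ᴴ = diagonal fun i => (b i : ℂ))
    {t : ℝ} (ht : t ∈ Set.Icc (0 : ℝ) 1) :
    (1 + T * diagonal (fun i => ((l i ^ t : ℝ) : ℂ)) * Tᴴ).det ≤
      (1 + diagonal (fun i => ((a i ^ (1 - t) : ℝ) : ℂ)) *
        (Mᴴ * diagonal (fun i => ((b i ^ t : ℝ) : ℂ)) * M)).det := by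
  rw [(isHermitian_mul_diagonal_ofReal_mul_conjTranspose T _).det_one_add_eq_sum_trace_compound]
  have hR : (1 + diagonal (fun i => ((a i ^ (1 - t) : ℝ) : ℂ)) *
        (Mᴴ * diagonal (fun i => ((b i ^ t : ℝ) : ℂ)) * M)).det =
      ∑ k ∈ Finset.range (n + 1), (compound k (diagonal (fun i => ((a i ^ (1 - t) : ℝ) : ℂ)) *
        (Mᴴ * diagonal (fun i => ((b i ^ t : ℝ) : ℂ)) * M))).trace := by
    set R : Matrix (Fin n) (Fin n) ℂ := diagonal fun i => ((a i ^ ((1 - t) / 2) : ℝ) : ℂ)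
    have hRR : diagonal (fun i => ((a i ^ (1 - t) : ℝ) : ℂ)) = R * R := by
      rw [diagonal_mul_diagonal]
      congr
      ext i
      rw [← Complex.ofReal_mul, ← Real.rpow_add (ha i)]
      congr
      ring
    have hRH : Rᴴ = R := by simp [R, diagonal_conjTranspose, Pi.star_def]
    rw [hRR, mul_assoc R R]
    apply det_one_add_eq_sum_trace_compound_comm
    have hconj : R * (Mᴴ * diagonal (fun i => ((b i ^ t : ℝ) : ℂ)) * M) * R =
        R * Mᴴ * diagonal (fun i => ((b i ^ t : ℝ) : ℂ)) * (R * Mᴴ)ᴴ := by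
      simp only [conjTranspose_mul, conjTranspose_conjTranspose, hRH, mul_assoc]
    rw [hconj]
    exact (isHermitian_mul_diagonal_ofReal_mul_conjTranspose
      (R * Mᴴ) _).det_one_add_eq_sum_trace_compound
  rw [hR]
  refine Finset.sum_le_sum fun k _ => ?_
  simp only [compound_mul, compound_conjTranspose, compound_diagonal_rpow k _ ha,
    compound_diagonal_rpow k _ hb, compound_diagonal_rpow k _ hl]
  rw [trace_mul_diagonal_mul_conjTranspose_self,
    trace_diagonal_mul_conjTranspose_mul_diagonal_mul, Complex.real_le_real]
  refine sum_rpow_le_sum_rpow_mul_rpow (compound k M) (compound k T) _ _ _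
    (fun s => Finset.prod_pos fun i _ => ha i) (fun s => Finset.prod_pos fun i _ => hb i)
    (fun s => Finset.prod_pos fun i _ => hl i) ?_ ?_ ?_ ?_ ht
  · rw [← compound_conjTranspose, ← compound_mul, hM, compound_one]
  · rw [← compound_conjTranspose, ← compound_mul, hM', compound_one]
  · rw [← compound_conjTranspose, ← compound_mul, hT, compound_diagonal_ofReal]
  · rw [← compound_diagonal_ofReal, ← compound_diagonal_ofReal, ← hN]
    simp only [compound_mul, compound_conjTranspose]

theorem Matrix.PosDef.exists_mpow_eq {n : ℕ} {A : Matrix (Fin n) (Fin n) ℂ} (hA : A.PosDef) :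
    ∃ (U : Matrix (Fin n) (Fin n) ℂ) (a : Fin n → ℝ), Uᴴ * U = 1 ∧ U * Uᴴ = 1 ∧
      (∀ i, 0 < a i) ∧ A = U * diagonal (fun i => (a i : ℂ)) * Uᴴ ∧
      ∀ r, mpow A r = U * diagonal (fun i => ((a i ^ r : ℝ) : ℂ)) * Uᴴ := by
  refine ⟨hA.1.eigenvectorUnitary, hA.1.eigenvalues, Unitary.coe_star_mul_self _,
    Unitary.coe_mul_star_self _, hA.eigenvalues_pos, hA.1.spectral_theorem, fun r => ?_⟩
  rw [mpow, dif_pos hA.1]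
  rfl

/-- `det(I + A♯ₜB) ≤ det(I + A^{1-t}Bᵗ)`. -/
theorem stmt_15 {n : ℕ} (A B : Matrix (Fin n) (Fin n) ℂ)
    (hA : A.PosDef) (hB : B.PosDef) (t : ℝ) (ht : t ∈ Set.Icc (0:ℝ) 1) :
    (1 + geomMean A B t).det ≤ (1 + mpow A (1 - t) * mpow B t).det := by
  obtain ⟨U, a, hU, hU', ha, hAU, hAp⟩ := hA.exists_mpow_eq
  obtain ⟨W, b, hW, hW', hb, hBW, hBp⟩ := hB.exists_mpow_eq
  have hherm (r : ℝ) : (mpow A r)ᴴ = mpow A r := by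
    rw [hAp]
    exact (isHermitian_mul_diagonal_ofReal_mul_conjTranspose U _).eq
  have hmul (r s : ℝ) : mpow A r * mpow A s = mpow A (r + s) := by
    rw [hAp, hAp, hAp]
    calc _ = U * (diagonal (fun i => ((a i ^ r : ℝ) : ℂ)) * (Uᴴ * U) *
          diagonal (fun i => ((a i ^ s : ℝ) : ℂ))) * Uᴴ := by simp only [mul_assoc]
      _ = _ := by
        rw [hU, mul_one, diagonal_mul_diagonal]
        simp_rw [← Complex.ofReal_mul, ← Real.rpow_add (ha _)]
  have hone : mpow A 1 = A := by rw [hAp]; simpa using hAU.symm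
  have hzero : mpow A 0 = 1 := by rw [hAp]; simpa using hU'
  set H := mpow A (1 / 2) with hH
  set H' := mpow A (-(1 / 2)) with hH'
  have hHH : H * H = A := by rw [hmul]; norm_num [hone]
  have hHH' : H * H' = 1 := by rw [hmul]; norm_num [hzero]
  have hH'H : H' * H = 1 := by rw [hmul]; norm_num [hzero]
  have hX : (H' * B * H').PosDef := by
    have := hB.mul_mul_conjTranspose_same (B := H')
      (Function.LeftInverse.injective (g := fun v => v ᵥ* H) fun v => by
        simp [vecMul_vecMul, hH'H])
    rwa [hherm] at this
  obtain ⟨V, l, hV, hV', hl, hXV, hXp⟩ := hX.exists_mpow_eq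
  have hB' : H * (H' * B * H') * H = B := by
    calc _ = (H * H') * B * (H' * H) := by simp only [mul_assoc]
      _ = B := by rw [hHH', hH'H, one_mul, mul_one]
  have key := det_one_add_le_det_one_add (Wᴴ * U) (Uᴴ * (H * V)) a b l ha hb hl
    (by
      calc _ = Uᴴ * (W * Wᴴ) * U := by simp [mul_assoc]
        _ = 1 := by rw [hW', mul_one, hU])
    (by
      calc _ = Wᴴ * (U * Uᴴ) * W := by simp [mul_assoc]
        _ = 1 := by rw [hU', mul_one, hW])
    (by
      calc _ = Uᴴ * (H * (V * Vᴴ) * Hᴴ) * U := by simp [mul_assoc]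
        _ = Uᴴ * (U * diagonal (fun i => (a i : ℂ)) * Uᴴ) * U := by
          rw [hV', mul_one, hherm, hHH, ← hAU]
        _ = (Uᴴ * U) * diagonal (fun i => (a i : ℂ)) * (Uᴴ * U) := by simp only [mul_assoc]
        _ = _ := by rw [hU, one_mul, mul_one])
    (by
      have hWU : Wᴴ * U * (Uᴴ * (H * V)) = Wᴴ * H * V := by
        calc _ = Wᴴ * (U * Uᴴ) * (H * V) := by simp only [mul_assoc]
          _ = _ := by rw [hU', mul_one, ← mul_assoc]
      rw [hWU]
      calc _ = Wᴴ * (H * (V * diagonal (fun i => (l i : ℂ)) * Vᴴ) * Hᴴ) * W := by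
            simp [mul_assoc]
        _ = Wᴴ * (W * diagonal (fun i => (b i : ℂ)) * Wᴴ) * W := by
          rw [← hXV, hherm, hB', ← hBW]
        _ = (Wᴴ * W) * diagonal (fun i => (b i : ℂ)) * (Wᴴ * W) := by simp only [mul_assoc]
        _ = _ := by rw [hW, one_mul, mul_one]) ht
  have hL : (1 + geomMean A B t).det = (1 + Uᴴ * (H * V) *
      diagonal (fun i => ((l i ^ t : ℝ) : ℂ)) * (Uᴴ * (H * V))ᴴ).det := by
    have : Uᴴ * (H * V) * diagonal (fun i => ((l i ^ t : ℝ) : ℂ)) * (Uᴴ * (H * V))ᴴ =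
        Uᴴ * (geomMean A B t * U) := by
      rw [geomMean, ← hH, ← hH', hXp]
      simp only [conjTranspose_mul, conjTranspose_conjTranspose, mul_assoc,
        hherm (1 / 2), hH]
    rw [this, det_one_add_mul_comm, mul_assoc, hU', mul_one]
  have hR : (1 + mpow A (1 - t) * mpow B t).det =
      (1 + diagonal (fun i => ((a i ^ (1 - t) : ℝ) : ℂ)) *
        ((Wᴴ * U)ᴴ * diagonal (fun i => ((b i ^ t : ℝ) : ℂ)) * (Wᴴ * U))).det := by
    rw [hAp, hBp, mul_assoc U, mul_assoc U, det_one_add_mul_comm]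
    simp only [conjTranspose_mul, conjTranspose_conjTranspose, mul_assoc]
  rw [hL, hR]
  exact key
end
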